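/- There is a universal constant C > 0 with the following property. Let T : ℂ^n → ℂ^N be injective with balancing parameter γ, incoherence parameter μ, and ‖γ T*T − I_n‖ < 1. Let Ω = {ω_1,…,ω_m} be i.i.d. uniform random indices in [n], let x ∈ ℂ^n have T x s-sparse, let β > 0, and suppose m ≥ C(1+β) μ s (1 − ‖γ T*T − I_n‖)^{-1} [ log N + log( ‖T‖_{1→2} ‖T†‖_{2→∞} ) ]. Let x♯ ∈ ℂ^n satisfy ‖S_{Ω'}(x − x♯)‖_2 ≤ ε and let x̂ be a minimizer of (Pε): minimize ‖T g‖_1 over g ∈ ℂ^n subject to ‖S_{Ω'}(g − x♯)‖_2 ≤ ε. Then, with probability at least 1 − e^{−β} − 3/n over Ω, ‖x̂ − x‖_2 ≤ (σ_max(T)/σ_min(T)) · { 2 + 28√N ( 3 n ‖T‖_{1→2} ‖T†‖_{2→∞} + 1 ) } · ε. -/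

import Mathlib

open scoped BigOperators ENNReal
open Classical MeasureTheory
open scoped Matrix

noncomputable section

namespace TSR

/-- ℓ2 norm of a finite complex vector. -/
def l2norm {d : ℕ} (v : Fin d → ℂ) : ℝ := Real.sqrt (∑ i, ‖v i‖ ^ 2)

/-- ℓ1 norm of a finite complex vector. -/
def l1norm {d : ℕ} (v : Fin d → ℂ) : ℝ := ∑ i, ‖v i‖

/-- ℓ∞ norm of a finite complex vector. -/
def linfnorm {d : ℕ} (v : Fin d → ℂ) : ℝ := ⨆ i, ‖v i‖

/-- Spectral norm (`ℓ2 → ℓ2` operator norm) of a matrix. -/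
def specNorm {d e : ℕ} (A : Matrix (Fin d) (Fin e) ℂ) : ℝ :=
  ‖LinearMap.toContinuousLinearMap (Matrix.toEuclideanLin A)‖

/-- Largest singular value. -/
def sigmaMax {d e : ℕ} (A : Matrix (Fin d) (Fin e) ℂ) : ℝ := specNorm A

/-- Smallest singular value: the infimum of `‖A v‖₂` over unit vectors `v`. -/
def sigmaMin {d e : ℕ} (A : Matrix (Fin d) (Fin e) ℂ) : ℝ :=
  sInf {r : ℝ | ∃ v : Fin e → ℂ, l2norm v = 1 ∧ r = l2norm (A.mulVec v)}

/-- Maximum ℓ2 norm of the columns of a matrix (the `1 → 2` operator norm). -/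
def maxColL2 {d e : ℕ} (A : Matrix (Fin d) (Fin e) ℂ) : ℝ :=
  ⨆ k : Fin e, l2norm (fun i => A i k)

/-- `B` is the Moore–Penrose pseudoinverse of `A` (the four Penrose conditions). -/
def IsMoorePenrose {ι κ : Type*} [Fintype ι] [Fintype κ] [DecidableEq ι] [DecidableEq κ]
    (A : Matrix ι κ ℂ) (B : Matrix κ ι ℂ) : Prop :=
  A * B * A = A ∧ B * A * B = B ∧ (A * B)ᴴ = A * B ∧ (B * A)ᴴ = B * A

/-- `γ > 0` minimizes `‖γ' T*T − I‖` over `γ' > 0` (the balancing parameter). -/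
def IsBalancing {e d : ℕ} (T : Matrix (Fin d) (Fin e) ℂ) (γ : ℝ) : Prop :=
  0 < γ ∧ ∀ γ' : ℝ, 0 < γ' →
    specNorm ((γ : ℂ) • (Tᴴ * T) - 1) ≤ specNorm ((γ' : ℂ) • (Tᴴ * T) - 1)

/-- Local incoherence parameter `n γ ‖A e_k‖_∞²` of the `k`-th column. -/
def locIncoh {e d : ℕ} (γ : ℝ) (A : Matrix (Fin d) (Fin e) ℂ) (k : Fin e) : ℝ :=
  (e : ℝ) * γ * (linfnorm fun i => A i k) ^ 2

/-- The (worst case) incoherence parameter `μ`. -/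
def incoherence {e d : ℕ} (γ : ℝ) (T Ttil : Matrix (Fin d) (Fin e) ℂ) : ℝ :=
  ⨆ k : Fin e, max (locIncoh γ T k) (locIncoh γ⁻¹ Ttil k)

/-- The variable-density weight `√(μ_k μ̃_k)`. -/
def vdWeight {e d : ℕ} (γ : ℝ) (T Ttil : Matrix (Fin d) (Fin e) ℂ) (k : Fin e) : ℝ :=
  Real.sqrt (locIncoh γ T k * locIncoh γ⁻¹ Ttil k)

/-- The average incoherence parameter `μ̄ = (1/n) ∑ √(μ_k μ̃_k)`. -/
def avgIncoh {e d : ℕ} (γ : ℝ) (T Ttil : Matrix (Fin d) (Fin e) ℂ) : ℝ :=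
  (1 / (e : ℝ)) * ∑ k, vdWeight γ T Ttil k

/-- The sampling matrix `S_Ω` of a multiset of indices `ω : Fin m → Fin n`. -/
def sampMat {n m : ℕ} (ω : Fin m → Fin n) : Matrix (Fin m) (Fin n) ℂ :=
  fun j k => if ω j = k then 1 else 0

/-- Coordinate projection `Π_J` onto a set of coordinates, as a matrix. -/
def projMat {d : ℕ} (J : Set (Fin d)) : Matrix (Fin d) (Fin d) ℂ :=
  fun i j => if i = j ∧ i ∈ J then 1 else 0

/-- Number of non-zero entries. -/
def sparsity {d : ℕ} (v : Fin d → ℂ) : ℕ :=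
  (Finset.univ.filter fun i => v i ≠ 0).card

/-- Number of distinct elements of the multiset `Ω` (that is, `|Ω'|`). -/
def distinctCard {n m : ℕ} (ω : Fin m → Fin n) : ℕ :=
  (Finset.image ω Finset.univ).card

/-- Maximal multiplicity of an element of the multiset `Ω`. -/
def maxMult {n m : ℕ} (ω : Fin m → Fin n) : ℕ :=
  Finset.univ.sup fun k : Fin n => (Finset.univ.filter fun j => ω j = k).card

/-- Entrywise complex signum. -/
def csgn {d : ℕ} (z : Fin d → ℂ) : Fin d → ℂ :=
  fun k => if z k = 0 then 0 else z k / (‖z k‖ : ℂ)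

/-- `G` is a partition of the coordinates into disjoint nonempty groups. -/
def IsPartition {L N : ℕ} (G : Fin N → Finset (Fin L)) : Prop :=
  (∀ j, (G j).Nonempty) ∧ (∀ j j', j ≠ j' → Disjoint (G j) (G j')) ∧
    Finset.univ.biUnion G = Finset.univ

/-- The mixed (group) norm `‖z‖_{𝒢,1} = ∑_j ‖Π_{𝒢_j} z‖₂`. -/
def mixedNorm {L N : ℕ} (G : Fin N → Finset (Fin L)) (z : Fin L → ℂ) : ℝ :=
  ∑ j, Real.sqrt (∑ i ∈ G j, ‖z i‖ ^ 2)

/-- `z` is `(s,t)` strongly group sparse with respect to the partition `G`. -/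
def StronglyGroupSparse {L N : ℕ} (G : Fin N → Finset (Fin L)) (s t : ℕ)
    (z : Fin L → ℂ) : Prop :=
  ∃ J : Finset (Fin N), (∀ i, z i ≠ 0 → i ∈ J.biUnion G) ∧
    (J.biUnion G).card ≤ t ∧ J.card ≤ s

/-- Group local incoherence `max_j n γ ‖Π_{𝒢_j} A e_k‖₂²`. -/
def groupLocIncoh {n L N : ℕ} (G : Fin N → Finset (Fin L)) (γ : ℝ)
    (A : Matrix (Fin L) (Fin n) ℂ) (k : Fin n) : ℝ :=
  ⨆ j : Fin N, (n : ℝ) * γ * ∑ i ∈ G j, ‖A i k‖ ^ 2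

/-- Group incoherence parameter `μ_𝒢`. -/
def groupIncoh {n L N : ℕ} (G : Fin N → Finset (Fin L)) (γ : ℝ)
    (T Ttil : Matrix (Fin L) (Fin n) ℂ) : ℝ :=
  ⨆ k : Fin n, max (groupLocIncoh G γ T k) (groupLocIncoh G γ⁻¹ Ttil k)

/-- Group variable density weight `√(μ_{𝒢,k} μ̃_{𝒢,k})`. -/
def groupVdWeight {n L N : ℕ} (G : Fin N → Finset (Fin L)) (γ : ℝ)
    (T Ttil : Matrix (Fin L) (Fin n) ℂ) (k : Fin n) : ℝ :=
  Real.sqrt (groupLocIncoh G γ T k * groupLocIncoh G γ⁻¹ Ttil k)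

/-- Group average incoherence `μ̄_𝒢`. -/
def groupAvgIncoh {n L N : ℕ} (G : Fin N → Finset (Fin L)) (γ : ℝ)
    (T Ttil : Matrix (Fin L) (Fin n) ℂ) : ℝ :=
  (1 / (n : ℝ)) * ∑ k, groupVdWeight G γ T Ttil k

/-- The unitary DFT matrix. -/
def dft (n : ℕ) : Matrix (Fin n) (Fin n) ℂ :=
  fun j k => ((1 / Real.sqrt n : ℝ) : ℂ) *
    Complex.exp (-(2 * Real.pi * Complex.I * (j : ℕ) * (k : ℕ)) / n)

/-- Second-order bound for the exponential of a quadratic perturbation. -/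
lemma exp_quadratic_le {R Q p η f : ℝ} (hR : R ^ 2 ≤ Q) (hQ : p ^ 2 * Q ≤ 1 / 2500)
    (hη : 0 ≤ η) (hf : 1 ≤ f) (hp : f * η = p) :
    Real.exp (f * (-2 * η * R + η ^ 2 * Q)) ≤ 1 - 2 * p * R + 10 * p ^ 2 * Q := by
  have hQ0 : 0 ≤ Q := (sq_nonneg R).trans hR
  have hηp : η ≤ p := by nlinarith
  have hp0 : 0 ≤ p := hη.trans hηp
  have h1 : (p * R) ^ 2 ≤ p ^ 2 * Q := by rw [mul_pow]; gcongr
  have h2 : p * η * Q ≤ p ^ 2 * Q := by rw [sq]; gcongr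
  have h3 : 0 ≤ p * η * Q := by positivity
  have hpR : |p * R| ≤ 1 / 50 := abs_le_of_sq_le_sq (by nlinarith) (by norm_num)
  obtain ⟨h4, h5⟩ := abs_le.1 hpR
  have hY : f * (-2 * η * R + η ^ 2 * Q) = -2 * (p * R) + p * η * Q := by rw [← hp]; ring
  rw [hY]
  have h6 := (abs_le.1 (Real.abs_exp_sub_one_sub_id_le
    (x := -2 * (p * R) + p * η * Q) (abs_le.2 ⟨by linarith, by linarith⟩))).2
  have h7 : (p * η * Q) ^ 2 ≤ (1 / 2500) * (p ^ 2 * Q) := by nlinarith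
  nlinarith [sq_nonneg (2 * (p * R) + p * η * Q)]

section Potential

variable {E : Type*} [NormedAddCommGroup E]

/-- The potential controlling the residual of the adaptive golfing iteration. -/
def potential (l : ℝ) (w : E) : ℝ := ‖w‖ ^ 2 * Real.exp (l * ‖w‖)

/-- The adaptive step size of the golfing iteration. -/
def stepSize (σ l : ℝ) (w : E) : ℝ := 1 / 150 / σ / (1 + l * ‖w‖ / 2)

lemma potential_nonneg (l : ℝ) (w : E) : 0 ≤ potential l w := by
  unfold potential; positivity

lemma stepSize_nonneg {σ l : ℝ} (hσ : 1 ≤ σ) (hl : 0 ≤ l) (w : E) : 0 ≤ stepSize σ l w := by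
  unfold stepSize; positivity

lemma stepSize_mul_norm_le {σ l : ℝ} (hσ : 1 ≤ σ) (hl : 0 < l) (w : E) :
    stepSize σ l w * ‖w‖ ≤ 1 / 75 / (σ * l) := by
  unfold stepSize
  have : 0 ≤ ‖w‖ := norm_nonneg w
  rw [div_div, div_mul_eq_mul_div, div_div, div_le_div_iff₀ (by positivity) (by positivity)]
  have : 0 ≤ σ := by linarith
  nlinarith [mul_nonneg this hl.le]

lemma norm_average_sq_le {n : ℕ} (hn : 0 < n) [NormedSpace ℂ E] (u : Fin n → E) :
    n * ‖((n : ℂ)⁻¹) • ∑ k, u k‖ ^ 2 ≤ ∑ k, ‖u k‖ ^ 2 := by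
  have hn' : (0 : ℝ) < n := by exact_mod_cast hn
  have h1 : ‖∑ k, u k‖ ^ 2 ≤ n * ∑ k, ‖u k‖ ^ 2 := by
    calc ‖∑ k, u k‖ ^ 2 ≤ (∑ k, ‖u k‖) ^ 2 := by gcongr; exact norm_sum_le _ _
      _ ≤ _ := by simpa using sq_sum_le_card_mul_sum_sq (s := Finset.univ) (f := fun k => ‖u k‖)
  rw [norm_smul, norm_inv, Complex.norm_natCast, mul_pow]
  calc (n : ℝ) * ((n : ℝ)⁻¹ ^ 2 * ‖∑ k, u k‖ ^ 2) ≤ n * ((n : ℝ)⁻¹ ^ 2 * (n * ∑ k, ‖u k‖ ^ 2)) := by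
        gcongr
    _ = _ := by field_simp

lemma norm_average_le {n : ℕ} (hn : 0 < n) [NormedSpace ℂ E] (u : Fin n → E) {B : ℝ}
    (h : ∀ k, ‖u k‖ ≤ B) :
    ‖((n : ℂ)⁻¹) • ∑ k, u k‖ ≤ B := by
  have hn' : (0 : ℝ) < n := by exact_mod_cast hn
  rw [norm_smul, norm_inv, Complex.norm_natCast, inv_mul_le_iff₀ hn']
  calc _ ≤ ∑ k, ‖u k‖ := norm_sum_le _ _
    _ ≤ ∑ _k : Fin n, B := Finset.sum_le_sum fun k _ => h k
    _ = _ := by simp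

variable [InnerProductSpace ℂ E]

lemma potential_step_le {σ l : ℝ} (hσ : 1 ≤ σ) (hl : 0 ≤ l) {w : E} (hw : w ≠ 0) {G : E}
    (hG : ‖G‖ ≤ 3 * σ * ‖w‖) :
    potential l (w - (stepSize σ l w : ℂ) • G) ≤ potential l w *
      (1 - 2 * (1 / 150 / σ) * ((inner ℂ w G).re / ‖w‖ ^ 2) +
        10 * (1 / 150 / σ) ^ 2 * (‖G‖ ^ 2 / ‖w‖ ^ 2)) := by
  have hq : 0 < ‖w‖ := norm_pos_iff.2 hw
  set q := ‖w‖
  set η := stepSize σ l w with hη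
  have hη0 : 0 ≤ η := stepSize_nonneg hσ hl w
  set f := 1 + l * q / 2 with hf
  have hf1 : 1 ≤ f := by
    have : 0 ≤ l * q := by positivity
    linarith
  have hfη : f * η = 1 / 150 / σ := by
    rw [hη, stepSize]
    exact mul_div_cancel₀ _ (by positivity)
  set R := (inner ℂ w G).re / q ^ 2 with hR
  set Q := ‖G‖ ^ 2 / q ^ 2 with hQ
  have hRabs : |(inner ℂ w G).re| ≤ q * ‖G‖ :=
    (Complex.abs_re_le_norm _).trans (norm_inner_le_norm _ _)
  have hRQ : R ^ 2 ≤ Q := by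
    rw [hR, hQ, div_pow, div_le_div_iff₀ (by positivity) (by positivity)]
    have := sq_le_sq' (abs_le.1 hRabs).1 (abs_le.1 hRabs).2
    nlinarith [sq_nonneg q]
  have hQσ : Q ≤ 9 * σ ^ 2 := by
    rw [hQ, div_le_iff₀ (by positivity)]
    calc ‖G‖ ^ 2 ≤ (3 * σ * q) ^ 2 := by gcongr
      _ = _ := by ring
  have hpQ : (1 / 150 / σ) ^ 2 * Q ≤ 1 / 2500 := by
    calc (1 / 150 / σ) ^ 2 * Q ≤ (1 / 150 / σ) ^ 2 * (9 * σ ^ 2) := by gcongr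
      _ = 1 / 2500 := by field_simp; norm_num
  set X := -2 * η * R + η ^ 2 * Q with hX
  have hsq : ‖w - (η : ℂ) • G‖ ^ 2 = q ^ 2 * (1 + X) := by
    rw [@norm_sub_sq ℂ, inner_smul_right, norm_smul, mul_pow]
    simp only [RCLike.re_to_complex, Complex.re_ofReal_mul, Complex.norm_real, Real.norm_eq_abs,
      sq_abs]
    rw [hX, hR, hQ]
    field_simp
    ring
  have hq' : ‖w - (η : ℂ) • G‖ ≤ q * (1 + X / 2) := by
    have := two_mul_le_add_sq ‖w - (η : ℂ) • G‖ q
    rw [hsq] at this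
    by_contra! hcon
    nlinarith
  have h1X : 1 + X ≤ Real.exp X := by linarith [Real.add_one_le_exp X]
  have hexp := exp_quadratic_le hRQ hpQ hη0 hf1 hfη
  unfold potential
  calc ‖w - (η : ℂ) • G‖ ^ 2 * Real.exp (l * ‖w - (η : ℂ) • G‖)
      ≤ (q ^ 2 * Real.exp X) * Real.exp (l * (q * (1 + X / 2))) := by
        rw [hsq]; gcongr
    _ = q ^ 2 * Real.exp (l * q) * Real.exp (f * X) := by
        rw [mul_assoc, mul_assoc, ← Real.exp_add, ← Real.exp_add, hf]; ring_nf
    _ ≤ _ := by gcongr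

lemma sum_potential_le {n : ℕ} (hn : 0 < n) {σ l : ℝ} (hσ : 1 ≤ σ) (hl : 0 ≤ l) (w : E)
    (u : Fin n → E) (hu : ∀ k, ‖u k‖ ≤ σ * ‖w‖)
    (hu2 : ∑ k, ‖u k‖ ^ 2 ≤ n * (2 * σ * ‖w‖ ^ 2)) :
    ∑ k, potential l (w - (stepSize σ l w : ℂ) • (u k + (w - (n : ℂ)⁻¹ • ∑ j, u j))) ≤
      n * Real.exp (-(1 / 150 / σ)) * potential l w := by
  have hn' : (0 : ℝ) < n := by exact_mod_cast hn
  set ub := (n : ℂ)⁻¹ • ∑ j, u j with hub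
  by_cases hw : w = 0
  · have h0 : ∀ k, u k = 0 := fun k => by simpa [hw] using hu k
    simp [hw, h0, hub, potential]
  have hq : 0 < ‖w‖ := norm_pos_iff.2 hw
  have hub1 : ‖ub‖ ≤ σ * ‖w‖ := norm_average_le hn u hu
  have hub2 : n * ‖ub‖ ^ 2 ≤ ∑ k, ‖u k‖ ^ 2 := norm_average_sq_le hn u
  have hG : ∀ k, ‖u k + (w - ub)‖ ≤ 3 * σ * ‖w‖ := fun k => by
    calc _ ≤ ‖u k‖ + (‖w‖ + ‖ub‖) := (norm_add_le _ _).trans (by gcongr; exact norm_sub_le _ _)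
      _ ≤ _ := by nlinarith [hu k]
  have hG2 : ∀ k, ‖u k + (w - ub)‖ ^ 2 ≤ 3 * (‖u k‖ ^ 2 + ‖w‖ ^ 2 + ‖ub‖ ^ 2) := fun k => by
    have : ‖u k + (w - ub)‖ ≤ ‖u k‖ + (‖w‖ + ‖ub‖) :=
      (norm_add_le _ _).trans (by gcongr; exact norm_sub_le _ _)
    calc _ ≤ (‖u k‖ + (‖w‖ + ‖ub‖)) ^ 2 := by gcongr
      _ ≤ _ := by
        nlinarith [sq_nonneg (‖u k‖ - ‖w‖), sq_nonneg (‖u k‖ - ‖ub‖), sq_nonneg (‖w‖ - ‖ub‖)]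
  have hsumG2 : ∑ k, ‖u k + (w - ub)‖ ^ 2 ≤ n * (15 * σ * ‖w‖ ^ 2) := by
    calc _ ≤ ∑ k, 3 * (‖u k‖ ^ 2 + ‖w‖ ^ 2 + ‖ub‖ ^ 2) := Finset.sum_le_sum fun k _ => hG2 k
      _ = 3 * (∑ k, ‖u k‖ ^ 2 + n * ‖w‖ ^ 2 + n * ‖ub‖ ^ 2) := by
        rw [← Finset.mul_sum, Finset.sum_add_distrib, Finset.sum_add_distrib]; simp
      _ ≤ _ := by
        have : (n : ℝ) * ‖w‖ ^ 2 ≤ n * (σ * ‖w‖ ^ 2) := by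
          gcongr; nlinarith [sq_nonneg ‖w‖]
        nlinarith
  have hsumG : ∑ k, (inner ℂ w (u k + (w - ub))).re = n * ‖w‖ ^ 2 := by
    rw [← Complex.re_sum, ← inner_sum]
    have : ∑ k, (u k + (w - ub)) = (n : ℂ) • w := by
      have hnC : (n : ℂ) ≠ 0 := by exact_mod_cast hn.ne'
      rw [Finset.sum_add_distrib, Finset.sum_const, Finset.card_univ, Fintype.card_fin,
        ← Nat.cast_smul_eq_nsmul ℂ, smul_sub, hub, smul_inv_smul₀ hnC]
      abel
    rw [this, inner_smul_right, Complex.mul_re, Complex.natCast_re, Complex.natCast_im, zero_mul,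
      sub_zero]
    congr 1
    exact inner_self_eq_norm_sq (𝕜 := ℂ) w
  calc _ ≤ ∑ k, potential l w *
      (1 - 2 * (1 / 150 / σ) * ((inner ℂ w (u k + (w - ub))).re / ‖w‖ ^ 2) +
        10 * (1 / 150 / σ) ^ 2 * (‖u k + (w - ub)‖ ^ 2 / ‖w‖ ^ 2)) :=
        Finset.sum_le_sum fun k _ => potential_step_le hσ hl hw (hG k)
    _ = potential l w * (n - 2 * (1 / 150 / σ) * ((∑ k, (inner ℂ w (u k + (w - ub))).re) / ‖w‖ ^ 2)
        + 10 * (1 / 150 / σ) ^ 2 * ((∑ k, ‖u k + (w - ub)‖ ^ 2) / ‖w‖ ^ 2)) := by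
      rw [← Finset.mul_sum, Finset.sum_add_distrib, Finset.sum_sub_distrib, ← Finset.mul_sum,
        ← Finset.mul_sum, Finset.sum_div, Finset.sum_div]
      simp
    _ ≤ potential l w * (n - 2 * (1 / 150 / σ) * ((n * ‖w‖ ^ 2) / ‖w‖ ^ 2)
        + 10 * (1 / 150 / σ) ^ 2 * ((n * (15 * σ * ‖w‖ ^ 2)) / ‖w‖ ^ 2)) := by
      rw [hsumG]
      have := potential_nonneg l w
      gcongr
    _ = potential l w * (n * (1 - 1 / 150 / σ)) := by field_simp; ring
    _ ≤ potential l w * (n * Real.exp (-(1 / 150 / σ))) := by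
      have := potential_nonneg l w
      gcongr
      linarith [Real.add_one_le_exp (-(1 / 150 / σ))]
    _ = _ := by ring

end Potential

/-- Moment generating function bound for a centred variable on a uniform finite space. -/
lemma sum_exp_le {n : ℕ} (x : Fin n → ℝ) (hx : ∑ k, x k = 0) (hx1 : ∀ k, |x k| ≤ 1) {V : ℝ}
    (hV : ∑ k, x k ^ 2 ≤ n * V) : ∑ k, Real.exp (x k) ≤ n * Real.exp V := by
  calc ∑ k, Real.exp (x k) ≤ ∑ k, (1 + x k + x k ^ 2) := Finset.sum_le_sum fun k _ => by
        linarith [(abs_le.1 (Real.abs_exp_sub_one_sub_id_le (hx1 k))).2]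
    _ = n + ∑ k, x k ^ 2 := by
        rw [Finset.sum_add_distrib, Finset.sum_add_distrib, hx]; simp
    _ ≤ n * (V + 1) := by linarith
    _ ≤ _ := by gcongr; exact Real.add_one_le_exp V

lemma sum_foldl_le {S : Type*} {n : ℕ} (step : S → Fin n → S) (Ψ : S → ℝ) {ρ : ℝ} (hρ : 0 ≤ ρ)
    (h : ∀ v, ∑ k, Ψ (step v k) ≤ ρ * Ψ v) (m : ℕ) (v : S) :
    ∑ ω : Fin m → Fin n, Ψ ((List.ofFn ω).foldl step v) ≤ ρ ^ m * Ψ v := by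
  induction m generalizing v with
  | zero => simp
  | succ m ih =>
    rw [← (Fin.consEquiv fun _ => Fin n).sum_comp, Fintype.sum_prod_type]
    simp only [Fin.consEquiv, Equiv.coe_fn_mk, List.ofFn_succ, Fin.cons_zero, Fin.cons_succ,
      List.foldl_cons]
    calc _ ≤ ∑ k, ρ ^ m * Ψ (step v k) := Finset.sum_le_sum fun k _ => ih _
      _ = ρ ^ m * ∑ k, Ψ (step v k) := by rw [Finset.mul_sum]
      _ ≤ ρ ^ m * (ρ * Ψ v) := by gcongr; exact h v
      _ = _ := by ring

lemma card_foldl_ge_le {S : Type*} {n : ℕ} (step : S → Fin n → S) (Ψ : S → ℝ) {ρ : ℝ}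
    (hρ : 0 ≤ ρ) (hΨ : ∀ v, 0 ≤ Ψ v) (h : ∀ v, ∑ k, Ψ (step v k) ≤ ρ * Ψ v) (m : ℕ) (v : S)
    (t : ℝ) :
    t * ((Finset.univ.filter fun ω : Fin m → Fin n =>
      t ≤ Ψ ((List.ofFn ω).foldl step v)).card : ℝ) ≤ ρ ^ m * Ψ v := by
  refine le_trans ?_ (sum_foldl_le step Ψ hρ h m v)
  rw [mul_comm, ← nsmul_eq_mul]
  refine (Finset.card_nsmul_le_sum _ (fun ω => Ψ ((List.ofFn ω).foldl step v)) t
    fun ω hω => (Finset.mem_filter.1 hω).2).trans ?_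
  exact Finset.sum_le_sum_of_subset_of_nonneg (Finset.filter_subset _ _) fun _ _ _ => hΨ _

section Golfing

variable {n N : ℕ}

/-- Restriction of a vector to a set of coordinates. -/
def restr (J : Finset (Fin N)) : EuclideanSpace ℂ (Fin N) →ₗ[ℂ] EuclideanSpace ℂ (Fin N) where
  toFun v := WithLp.toLp 2 fun i => if i ∈ J then v i else 0
  map_add' v w := by ext i; by_cases h : i ∈ J <;> simp [h]
  map_smul' c v := by ext i; by_cases h : i ∈ J <;> simp [h]

lemma restr_apply (J : Finset (Fin N)) (v : EuclideanSpace ℂ (Fin N)) (i : Fin N) :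
    restr J v i = if i ∈ J then v i else 0 := rfl

lemma restr_restr (J : Finset (Fin N)) (v : EuclideanSpace ℂ (Fin N)) :
    restr J (restr J v) = restr J v := by
  ext i; by_cases h : i ∈ J <;> simp [restr_apply, h]

lemma inner_restr_left (J : Finset (Fin N)) (v w : EuclideanSpace ℂ (Fin N)) :
    inner ℂ (restr J v) w = inner ℂ v (restr J w) := by
  simp only [PiLp.inner_apply]
  refine Finset.sum_congr rfl fun i _ => ?_
  by_cases h : i ∈ J <;> simp [restr_apply, h]

lemma norm_restr_sq (J : Finset (Fin N)) (v : EuclideanSpace ℂ (Fin N)) :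
    ‖restr J v‖ ^ 2 = ∑ i ∈ J, ‖v i‖ ^ 2 := by
  rw [EuclideanSpace.norm_sq_eq, ← Finset.sum_filter_add_sum_filter_not Finset.univ (· ∈ J),
    Finset.sum_eq_zero (s := Finset.univ.filter fun i => ¬ i ∈ J), add_zero, Finset.filter_univ_mem]
  · exact Finset.sum_congr rfl fun i hi => by simp [restr_apply, hi]
  · intro i hi
    simp [restr_apply, (Finset.mem_filter.1 hi).2]

lemma norm_restr_sq_le {J : Finset (Fin N)} {v : EuclideanSpace ℂ (Fin N)} {μ : ℝ}
    (h : ∀ i, n * ‖v i‖ ^ 2 ≤ μ) : n * ‖restr J v‖ ^ 2 ≤ J.card * μ := by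
  rw [norm_restr_sq, Finset.mul_sum, ← nsmul_eq_mul]
  exact Finset.sum_le_card_nsmul _ _ _ fun i _ => h i

/-- The contribution of one sample to the dual certificate. -/
def sample (a b : Fin n → EuclideanSpace ℂ (Fin N)) (w : EuclideanSpace ℂ (Fin N)) (k : Fin n) :
    EuclideanSpace ℂ (Fin N) :=
  (n : ℂ) • (inner ℂ (a k) w • b k)

/-- The update direction of the golfing iteration; its average over all samples is `w`. -/
def drift (a b : Fin n → EuclideanSpace ℂ (Fin N)) (w : EuclideanSpace ℂ (Fin N)) (k : Fin n) :
    EuclideanSpace ℂ (Fin N) :=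
  sample a b w k + (w - (n : ℂ)⁻¹ • ∑ j, sample a b w j)

/-- One step of the adaptive golfing iteration. -/
def golfStep (a b : Fin n → EuclideanSpace ℂ (Fin N)) (J : Finset (Fin N)) (σ l : ℝ)
    (w₀ v : EuclideanSpace ℂ (Fin N)) (k : Fin n) : EuclideanSpace ℂ (Fin N) :=
  v + (stepSize σ l (w₀ - restr J v) : ℂ) • drift a b (w₀ - restr J v) k

variable {a b : Fin n → EuclideanSpace ℂ (Fin N)} {J : Finset (Fin N)} {μ σ : ℝ}
  {w : EuclideanSpace ℂ (Fin N)}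

lemma norm_sample_apply (k : Fin n) (i : Fin N) :
    ‖sample a b w k i‖ = n * (‖inner ℂ (a k) w‖ * ‖b k i‖) := by
  simp [sample]

lemma norm_restr_sample (k : Fin n) :
    ‖restr J (sample a b w k)‖ = n * (‖inner ℂ (a k) w‖ * ‖restr J (b k)‖) := by
  rw [sample, map_smul, map_smul, norm_smul, norm_smul, Complex.norm_natCast]

lemma norm_inner_le_of_supported (hw : restr J w = w) (x : EuclideanSpace ℂ (Fin N)) :
    ‖inner ℂ x w‖ ≤ ‖restr J x‖ * ‖w‖ := by
  rw [← hw, ← inner_restr_left, hw]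
  exact norm_inner_le_norm _ _

lemma norm_restr_sample_le (ha : ∀ k i, n * ‖a k i‖ ^ 2 ≤ μ) (hb : ∀ k i, n * ‖b k i‖ ^ 2 ≤ μ)
    (hJ : J.card * μ ≤ σ) (hw : restr J w = w) (k : Fin n) :
    ‖restr J (sample a b w k)‖ ≤ σ * ‖w‖ := by
  rw [norm_restr_sample]
  have h1 := norm_restr_sq_le (J := J) (ha k)
  have h2 := norm_restr_sq_le (J := J) (hb k)
  calc _ ≤ n * ((‖restr J (a k)‖ * ‖w‖) * ‖restr J (b k)‖) := by
        gcongr; exact norm_inner_le_of_supported hw _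
    _ = (n * (‖restr J (a k)‖ * ‖restr J (b k)‖)) * ‖w‖ := by ring
    _ ≤ _ := by
        gcongr
        have := two_mul_le_add_sq ‖restr J (a k)‖ ‖restr J (b k)‖
        have hn : (0 : ℝ) ≤ n := by positivity
        nlinarith

lemma sum_norm_restr_sample_sq_le (hb : ∀ k i, n * ‖b k i‖ ^ 2 ≤ μ)
    (hop : ∀ w, ∑ k, ‖inner ℂ (a k) w‖ ^ 2 ≤ 2 * ‖w‖ ^ 2) (hJ : J.card * μ ≤ σ) (hσ : 0 ≤ σ) :
    ∑ k, ‖restr J (sample a b w k)‖ ^ 2 ≤ n * (2 * σ * ‖w‖ ^ 2) := by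
  calc _ ≤ ∑ k, n * σ * ‖inner ℂ (a k) w‖ ^ 2 := by
        refine Finset.sum_le_sum fun k _ => ?_
        have h2 := norm_restr_sq_le (J := J) (hb k)
        rw [norm_restr_sample]
        calc _ = n * ‖inner ℂ (a k) w‖ ^ 2 * (n * ‖restr J (b k)‖ ^ 2) := by ring
          _ ≤ n * ‖inner ℂ (a k) w‖ ^ 2 * σ := by gcongr; linarith
          _ = _ := by ring
    _ = n * σ * ∑ k, ‖inner ℂ (a k) w‖ ^ 2 := by rw [Finset.mul_sum]
    _ ≤ n * σ * (2 * ‖w‖ ^ 2) := by gcongr; exact hop w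
    _ = _ := by ring

lemma norm_sample_apply_le (hμ : 0 ≤ μ) (ha : ∀ k i, n * ‖a k i‖ ^ 2 ≤ μ)
    (hb : ∀ k i, n * ‖b k i‖ ^ 2 ≤ μ) (hw : restr J w = w) (k : Fin n) (i : Fin N) :
    ‖sample a b w k i‖ ≤ √J.card * μ * ‖w‖ := by
  rw [norm_sample_apply]
  have h1 := norm_restr_sq_le (J := J) (ha k)
  calc _ ≤ n * ((‖restr J (a k)‖ * ‖w‖) * ‖b k i‖) := by
        gcongr; exact norm_inner_le_of_supported hw _
    _ = (n * (‖restr J (a k)‖ * ‖b k i‖)) * ‖w‖ := by ring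
    _ ≤ _ := by
        gcongr ?_ * _
        refine (sq_le_sq₀ (by positivity) (by positivity)).1 ?_
        rw [mul_pow (√(J.card : ℝ)), Real.sq_sqrt (by positivity)]
        calc _ = (n * ‖restr J (a k)‖ ^ 2) * (n * ‖b k i‖ ^ 2) := by ring
          _ ≤ (J.card * μ) * μ := by gcongr; exact hb k i
          _ = _ := by ring

lemma sum_norm_sample_apply_sq_le (hμ : 0 ≤ μ) (hb : ∀ k i, n * ‖b k i‖ ^ 2 ≤ μ)
    (hop : ∀ w, ∑ k, ‖inner ℂ (a k) w‖ ^ 2 ≤ 2 * ‖w‖ ^ 2) (i : Fin N) :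
    ∑ k, ‖sample a b w k i‖ ^ 2 ≤ n * (2 * μ * ‖w‖ ^ 2) := by
  calc _ ≤ ∑ k, n * μ * ‖inner ℂ (a k) w‖ ^ 2 := by
        refine Finset.sum_le_sum fun k _ => ?_
        rw [norm_sample_apply]
        calc _ = n * ‖inner ℂ (a k) w‖ ^ 2 * (n * ‖b k i‖ ^ 2) := by ring
          _ ≤ n * ‖inner ℂ (a k) w‖ ^ 2 * μ := by gcongr; exact hb k i
          _ = _ := by ring
    _ = n * μ * ∑ k, ‖inner ℂ (a k) w‖ ^ 2 := by rw [Finset.mul_sum]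
    _ ≤ n * μ * (2 * ‖w‖ ^ 2) := by gcongr; exact hop w
    _ = _ := by ring

lemma restr_residual {w₀ : EuclideanSpace ℂ (Fin N)} (hw₀ : restr J w₀ = w₀)
    (v : EuclideanSpace ℂ (Fin N)) : restr J (w₀ - restr J v) = w₀ - restr J v := by
  rw [map_sub, restr_restr, hw₀]

lemma restr_drift (hw : restr J w = w) (k : Fin n) :
    restr J (drift a b w k) =
      restr J (sample a b w k) + (w - (n : ℂ)⁻¹ • ∑ j, restr J (sample a b w j)) := by
  rw [drift, map_add, map_sub, map_smul, map_sum, hw]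

lemma inner_drift_eq_zero (hn : 0 < n)
    (hab : ∀ j k, inner ℂ (b j) (a k) = if j = k then (1 : ℂ) else 0)
    {h : Fin n → ℂ} {k : Fin n} (hk : h k = 0) :
    inner ℂ (drift a b w k) (∑ j, h j • a j) = 0 := by
  have hnC : (n : ℂ) ≠ 0 := by exact_mod_cast hn.ne'
  have hb : ∀ j, inner ℂ (b j) (∑ i, h i • a i) = h j := fun j => by
    simp only [inner_sum, inner_smul_right, hab]
    simp
  have hs : (n : ℂ)⁻¹ • ∑ j, sample a b w j = ∑ j, inner ℂ (a j) w • b j := by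
    simp only [sample]
    rw [← Finset.smul_sum, inv_smul_smul₀ hnC]
  have h1 : inner ℂ (sample a b w k) (∑ j, h j • a j) = 0 := by
    rw [sample, inner_smul_left, inner_smul_left, hb, hk]; simp
  rw [drift, hs, inner_add_left, h1, inner_sub_left, sum_inner, inner_sum, zero_add, sub_eq_zero]
  refine Finset.sum_congr rfl fun j _ => ?_
  rw [inner_smul_left, hb, inner_smul_right, inner_conj_symm, mul_comm]

lemma inner_foldl_eq_zero {h : Fin n → ℂ} (hn : 0 < n)
    (hab : ∀ j k, inner ℂ (b j) (a k) = if j = k then (1 : ℂ) else 0) (l : ℝ)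
    (w₀ : EuclideanSpace ℂ (Fin N)) (L : List (Fin n)) (hL : ∀ k ∈ L, h k = 0)
    (v : EuclideanSpace ℂ (Fin N)) (hv : inner ℂ v (∑ j, h j • a j) = 0) :
    inner ℂ (L.foldl (golfStep a b J σ l w₀) v) (∑ j, h j • a j) = 0 := by
  induction L generalizing v with
  | nil => simpa using hv
  | cons k L ih =>
    refine ih (fun j hj => hL j (List.mem_cons_of_mem _ hj)) _ ?_
    rw [golfStep, inner_add_left, inner_smul_left, hv,
      inner_drift_eq_zero hn hab (hL k List.mem_cons_self)]
    simp

lemma sum_potential_golfStep_le (hn : 0 < n) (hσ : 1 ≤ σ) {l : ℝ} (hl : 0 ≤ l)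
    (ha : ∀ k i, n * ‖a k i‖ ^ 2 ≤ μ) (hb : ∀ k i, n * ‖b k i‖ ^ 2 ≤ μ)
    (hop : ∀ w, ∑ k, ‖inner ℂ (a k) w‖ ^ 2 ≤ 2 * ‖w‖ ^ 2) (hJ : J.card * μ ≤ σ)
    {w₀ : EuclideanSpace ℂ (Fin N)} (hw₀ : restr J w₀ = w₀) (v : EuclideanSpace ℂ (Fin N)) :
    ∑ k, potential l (w₀ - restr J (golfStep a b J σ l w₀ v k)) ≤
      n * Real.exp (-(1 / 150 / σ)) * potential l (w₀ - restr J v) := by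
  have hw := restr_residual hw₀ v
  convert sum_potential_le hn hσ hl (w₀ - restr J v)
    (fun k => restr J (sample a b (w₀ - restr J v) k))
    (norm_restr_sample_le ha hb hJ hw)
    (sum_norm_restr_sample_sq_le hb hop hJ (by linarith)) using 3 with k
  rw [golfStep, map_add, map_smul, restr_drift hw]
  abel

lemma sum_exp_golfStep_le (hn : 0 < n) (hσ : 1 ≤ σ) (hμ : 0 ≤ μ) {τ : ℝ} (hτ : 0 < τ)
    (ha : ∀ k i, n * ‖a k i‖ ^ 2 ≤ μ) (hb : ∀ k i, n * ‖b k i‖ ^ 2 ≤ μ)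
    (hop : ∀ w, ∑ k, ‖inner ℂ (a k) w‖ ^ 2 ≤ 2 * ‖w‖ ^ 2) (hJ : J.card * μ ≤ σ)
    (hJ0 : 0 < J.card)
    {w₀ : EuclideanSpace ℂ (Fin N)} (hw₀ : restr J w₀ = w₀) {i : Fin N} (hi : i ∉ J) {z : ℂ}
    (hz : ‖z‖ = 1) (v : EuclideanSpace ℂ (Fin N)) :
    ∑ k, Real.exp (τ / 1024 * (z * golfStep a b J σ (τ / (300 * √J.card)) w₀ v k i).re) ≤
      n * Real.exp (1 / 8192 / σ) * Real.exp (τ / 1024 * (z * v i).re) := by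
  have hJ0' : (0 : ℝ) < J.card := by exact_mod_cast hJ0
  have hσ0 : 0 < σ := by linarith
  set l := τ / (300 * √J.card) with hl
  have hl0 : 0 < l := by positivity
  have hw := restr_residual hw₀ v
  set w := w₀ - restr J v with hwdef
  have hwi : w i = 0 := by rw [← hw, restr_apply, if_neg hi]
  set η := stepSize σ l w with hη
  have hη0 : 0 ≤ η := stepSize_nonneg hσ hl0.le w
  have hηw : η * ‖w‖ ≤ 1 / 75 / (σ * l) := stepSize_mul_norm_le hσ hl0 w
  set c : Fin n → ℂ := fun k => sample a b w k i with hc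
  set cb : ℂ := (n : ℂ)⁻¹ • ∑ j, c j with hcb
  set x : Fin n → ℝ := fun k => τ / 1024 * η * (z * (c k - cb)).re with hx
  have hstep : ∀ k, golfStep a b J σ l w₀ v k i = v i + (η : ℂ) * (c k - cb) := fun k => by
    simp [golfStep, drift, ← hwdef, hwi, hc, hcb, ← hη, sub_eq_add_neg, mul_add]
  have hexp : ∀ k, Real.exp (τ / 1024 * (z * golfStep a b J σ l w₀ v k i).re) =
      Real.exp (x k) * Real.exp (τ / 1024 * (z * v i).re) := fun k => by
    rw [← Real.exp_add, hstep, hx]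
    congr 1
    simp only [Complex.mul_re, Complex.add_re, Complex.add_im, Complex.mul_im, Complex.ofReal_re,
      Complex.ofReal_im]
    ring
  simp only [hexp]
  rw [← Finset.sum_mul]
  gcongr
  have hc1 : ∀ k, ‖c k‖ ≤ √J.card * μ * ‖w‖ := fun k => norm_sample_apply_le hμ ha hb hw k i
  have hcb1 : ‖cb‖ ≤ √J.card * μ * ‖w‖ := norm_average_le hn c hc1
  have hc2 : ∑ k, ‖c k‖ ^ 2 ≤ n * (2 * μ * ‖w‖ ^ 2) := sum_norm_sample_apply_sq_le hμ hb hop i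
  have hcb2 : n * ‖cb‖ ^ 2 ≤ ∑ k, ‖c k‖ ^ 2 := norm_average_sq_le hn c
  have hre : ∀ k, |(z * (c k - cb)).re| ≤ ‖c k‖ + ‖cb‖ := fun k => by
    refine (Complex.abs_re_le_norm _).trans ?_
    rw [norm_mul, hz, one_mul]
    exact norm_sub_le _ _
  have hsq : √(J.card : ℝ) ^ 2 = J.card := Real.sq_sqrt hJ0'.le
  have hs0 : 0 < √(J.card : ℝ) := by positivity
  refine sum_exp_le x ?_ ?_ ?_
  · have h0 : ∑ k, (c k - cb) = 0 := by
      have hnC : (n : ℂ) ≠ 0 := by exact_mod_cast hn.ne'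
      rw [Finset.sum_sub_distrib, hcb]
      simp [hnC]
    rw [hx, ← Finset.mul_sum, ← Complex.re_sum, ← Finset.mul_sum, h0]
    simp
  · intro k
    rw [hx]
    simp only [abs_mul, abs_of_nonneg hη0, abs_of_pos (show (0 : ℝ) < τ / 1024 by positivity)]
    calc τ / 1024 * η * |(z * (c k - cb)).re|
        ≤ τ / 1024 * η * (√J.card * μ * ‖w‖ + √J.card * μ * ‖w‖) := by
          gcongr; exact (hre k).trans (add_le_add (hc1 k) hcb1)
      _ = τ / 512 * √J.card * μ * (η * ‖w‖) := by ring
      _ ≤ τ / 512 * √J.card * μ * (1 / 75 / (σ * l)) := by gcongr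
      _ = (1 / 128) * (√(J.card : ℝ) ^ 2 * μ / σ) := by rw [hl]; field_simp; ring
      _ ≤ (1 / 128) * 1 := by
          rw [hsq]; gcongr; rw [div_le_one hσ0]; exact hJ
      _ ≤ 1 := by norm_num
  · calc ∑ k, x k ^ 2 ≤ ∑ k, (τ / 1024 * η) ^ 2 * (2 * (‖c k‖ ^ 2 + ‖cb‖ ^ 2)) := by
          refine Finset.sum_le_sum fun k _ => ?_
          rw [hx, mul_pow]
          gcongr
          rw [← sq_abs]
          calc |(z * (c k - cb)).re| ^ 2 ≤ (‖c k‖ + ‖cb‖) ^ 2 := by gcongr; exact hre k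
            _ ≤ _ := add_sq_le
      _ = (τ / 1024 * η) ^ 2 * (2 * (∑ k, ‖c k‖ ^ 2 + n * ‖cb‖ ^ 2)) := by
          rw [← Finset.mul_sum, ← Finset.mul_sum, Finset.sum_add_distrib]; simp
      _ ≤ (τ / 1024 * η) ^ 2 * (2 * (n * (2 * μ * ‖w‖ ^ 2) + n * (2 * μ * ‖w‖ ^ 2))) := by
          gcongr ?_ ^ 2 * (2 * (?_ + ?_))
          exact hcb2.trans hc2
      _ = n * (8 * (τ / 1024) ^ 2 * μ * (η * ‖w‖) ^ 2) := by ring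
      _ ≤ n * (8 * (τ / 1024) ^ 2 * μ * (1 / 75 / (σ * l)) ^ 2) := by gcongr
      _ = n * ((1 / 8192 / σ) * (√(J.card : ℝ) ^ 2 * μ / σ)) := by
          rw [hl]; field_simp; ring
      _ ≤ n * ((1 / 8192 / σ) * 1) := by
          rw [hsq]; gcongr; rw [div_le_one hσ0]; exact hJ
      _ = _ := by ring

/-- A dual certificate for the direction `w₀` exists for the sample `ω`. -/
def Certified {m : ℕ} (a : Fin n → EuclideanSpace ℂ (Fin N)) (J : Finset (Fin N))
    (w₀ : EuclideanSpace ℂ (Fin N)) (ω : Fin m → Fin n) : Prop :=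
  ∃ v : EuclideanSpace ℂ (Fin N),
    (∀ h : Fin n → ℂ, (∀ j, h (ω j) = 0) → inner ℂ v (∑ k, h k • a k) = 0) ∧
    ‖w₀ - restr J v‖ ≤ 1 / 4 ∧ ∀ i ∉ J, ‖v i‖ ≤ 1 / 2

lemma card_not_certified_le {m : ℕ} (hn : 0 < n) (hm : 0 < m) (hσ : 1 ≤ σ) (hμ : 0 ≤ μ)
    (ha : ∀ k i, n * ‖a k i‖ ^ 2 ≤ μ) (hb : ∀ k i, n * ‖b k i‖ ^ 2 ≤ μ)
    (hop : ∀ w, ∑ k, ‖inner ℂ (a k) w‖ ^ 2 ≤ 2 * ‖w‖ ^ 2)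
    (hab : ∀ j k, inner ℂ (b j) (a k) = if j = k then (1 : ℂ) else 0)
    (hJ : J.card * μ ≤ σ) (hJ0 : 0 < J.card)
    {w₀ : EuclideanSpace ℂ (Fin N)} (hw₀ : restr J w₀ = w₀) (hw₀' : ‖w₀‖ ≤ √J.card) :
    ((Finset.univ.filter fun ω : Fin m → Fin n => ¬ Certified a J w₀ ω).card : ℝ) ≤
      20 * N * (n ^ m * Real.exp (-(m / σ / 8192))) := by
  have hJ0' : (0 : ℝ) < J.card := by exact_mod_cast hJ0
  have hn' : (0 : ℝ) < n := by exact_mod_cast hn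
  have hm' : (0 : ℝ) < m := by exact_mod_cast hm
  have hσ0 : 0 < σ := by linarith
  set τ : ℝ := m / σ with hτdef
  have hτ : 0 < τ := by positivity
  set l := τ / (300 * √J.card) with hl
  have hl0 : 0 < l := by positivity
  set run : (Fin m → Fin n) → EuclideanSpace ℂ (Fin N) := fun ω =>
    (List.ofFn ω).foldl (golfStep a b J σ l w₀) 0 with hrun
  set Z : Finset ℂ := {1, -1, Complex.I, -Complex.I} with hZ
  have hZcard : Z.card ≤ 4 := Finset.card_le_four
  have hZnorm : ∀ z ∈ Z, ‖z‖ = 1 := by simp [hZ]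
  set F1 := Finset.univ.filter fun ω : Fin m → Fin n =>
    1 / 16 ≤ potential l (w₀ - restr J (run ω)) with hF1
  set F2 : Fin N × ℂ → Finset (Fin m → Fin n) := fun p => Finset.univ.filter fun ω =>
    Real.exp (τ / 4096) ≤ Real.exp (τ / 1024 * (p.2 * run ω p.1).re) with hF2
  set q := (n : ℝ) ^ m * Real.exp (-(τ / 8192)) with hq
  have hq0 : 0 < q := by positivity
  have hsub : (Finset.univ.filter fun ω : Fin m → Fin n => ¬ Certified a J w₀ ω) ⊆
      F1 ∪ ((Finset.univ.filter fun i => i ∉ J) ×ˢ Z).biUnion F2 := by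
    intro ω hω
    by_contra hcon
    refine (Finset.mem_filter.1 hω).2 ⟨run ω, ?_, ?_, ?_⟩
    · intro h hh
      refine inner_foldl_eq_zero hn hab l w₀ _ ?_ 0 (inner_zero_left _)
      intro k hk
      obtain ⟨j, rfl⟩ := (List.mem_ofFn' ω k).1 hk
      exact hh j
    · by_contra! hlt
      refine hcon (Finset.mem_union_left _ (Finset.mem_filter.2 ⟨Finset.mem_univ _, ?_⟩))
      unfold potential
      have h1 : 1 ≤ Real.exp (l * ‖w₀ - restr J (run ω)‖) := Real.one_le_exp (by positivity)
      have h2 : (1 / 4 : ℝ) ^ 2 ≤ ‖w₀ - restr J (run ω)‖ ^ 2 := by gcongr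
      nlinarith
    · intro i hi
      have key : ∀ z ∈ Z, (z * run ω i).re < 1 / 4 := by
        intro z hz
        by_contra! hle
        refine hcon (Finset.mem_union_right _ (Finset.mem_biUnion.2 ⟨(i, z), ?_, ?_⟩))
        · simp [hi, hz]
        · refine Finset.mem_filter.2 ⟨Finset.mem_univ _, Real.exp_le_exp.2 ?_⟩
          have := mul_le_mul_of_nonneg_left hle (show 0 ≤ τ / 1024 by positivity)
          linarith
      have k1 := key 1 (by simp [hZ])
      have k2 := key (-1) (by simp [hZ])
      have k3 := key Complex.I (by simp [hZ])
      have k4 := key (-Complex.I) (by simp [hZ])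
      simp at k1 k2 k3 k4
      have h5 : |(run ω i).re| ≤ 1 / 4 := abs_le.2 ⟨by linarith, by linarith⟩
      have h6 : |(run ω i).im| ≤ 1 / 4 := abs_le.2 ⟨by linarith, by linarith⟩
      linarith [Complex.norm_le_abs_re_add_abs_im (run ω i)]
  have hcard1 : (F1.card : ℝ) ≤ 16 * N * q := by
    have h1 := card_foldl_ge_le (golfStep a b J σ l w₀) (fun v => potential l (w₀ - restr J v))
      (ρ := n * Real.exp (-(1 / 150 / σ))) (by positivity) (fun v => potential_nonneg _ _)
      (fun v => sum_potential_golfStep_le hn hσ hl0.le ha hb hop hJ hw₀ v) m 0 (1 / 16)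
    have h2 : potential l (w₀ - restr J 0) ≤ N * Real.exp (τ / 300) := by
      rw [map_zero, sub_zero, potential]
      gcongr
      · calc (‖w₀‖ ^ 2 : ℝ) ≤ √(J.card : ℝ) ^ 2 := by gcongr
          _ = (J.card : ℝ) := Real.sq_sqrt hJ0'.le
          _ ≤ (N : ℝ) := by exact_mod_cast card_finset_fin_le J
      · calc l * ‖w₀‖ ≤ l * √J.card := by gcongr
          _ = τ / 300 := by rw [hl]; field_simp
    have h3 : (n * Real.exp (-(1 / 150 / σ))) ^ m * (N * Real.exp (τ / 300)) ≤ N * q := by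
      rw [mul_pow, ← Real.exp_nat_mul, hq]
      calc _ = N * (n ^ m * (Real.exp (m * -(1 / 150 / σ)) * Real.exp (τ / 300))) := by ring
        _ ≤ _ := by
          rw [← Real.exp_add]
          gcongr
          have : m * -(1 / 150 / σ) = - τ / 150 := by rw [hτdef]; ring
          rw [this]; linarith
    have h4 : (n * Real.exp (-(1 / 150 / σ))) ^ m * potential l (w₀ - restr J 0) ≤ N * q :=
      le_trans (by gcongr) h3
    have h5 := h1.trans h4
    linarith
  have hcard2 : ∀ p ∈ (Finset.univ.filter fun i => i ∉ J) ×ˢ Z, ((F2 p).card : ℝ) ≤ q := by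
    rintro ⟨i, z⟩ hp
    obtain ⟨hi, hz⟩ := Finset.mem_product.1 hp
    have hi' : i ∉ J := (Finset.mem_filter.1 hi).2
    have h1 := card_foldl_ge_le (golfStep a b J σ l w₀)
      (fun v => Real.exp (τ / 1024 * (z * v i).re))
      (ρ := n * Real.exp (1 / 8192 / σ)) (by positivity) (fun v => (Real.exp_pos _).le)
      (fun v => sum_exp_golfStep_le hn hσ hμ hτ ha hb hop hJ hJ0 hw₀ hi' (hZnorm z hz) v) m 0
      (Real.exp (τ / 4096))
    have h2 : (n * Real.exp (1 / 8192 / σ)) ^ m *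
        Real.exp (τ / 1024 * (z * (0 : EuclideanSpace ℂ (Fin N)) i).re) =
        Real.exp (τ / 4096) * q := by
      have : m * (1 / 8192 / σ) = τ / 4096 + -(τ / 8192) := by rw [hτdef]; ring
      rw [mul_pow, ← Real.exp_nat_mul, hq, this, Real.exp_add]
      simp
      ring
    rw [h2] at h1
    exact le_of_mul_le_mul_left h1 (Real.exp_pos _)
  have hcard2' : ((((Finset.univ.filter fun i => i ∉ J) ×ˢ Z).biUnion F2).card : ℝ) ≤
      4 * N * q := by
    calc ((((Finset.univ.filter fun i => i ∉ J) ×ˢ Z).biUnion F2).card : ℝ)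
        ≤ ∑ p ∈ (Finset.univ.filter fun i => i ∉ J) ×ˢ Z, ((F2 p).card : ℝ) := by
          exact_mod_cast Finset.card_biUnion_le
      _ ≤ ((Finset.univ.filter fun i => i ∉ J) ×ˢ Z).card * q := by
          rw [← nsmul_eq_mul]; exact Finset.sum_le_card_nsmul _ _ _ hcard2
      _ ≤ (N * 4) * q := by
          rw [Finset.card_product]
          push_cast
          gcongr
          · exact card_finset_fin_le _
          · exact_mod_cast hZcard
      _ = _ := by ring
  calc _ ≤ ((F1 ∪ ((Finset.univ.filter fun i => i ∉ J) ×ˢ Z).biUnion F2).card : ℝ) := by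
        exact_mod_cast Finset.card_le_card hsub
    _ ≤ F1.card + (((Finset.univ.filter fun i => i ∉ J) ×ˢ Z).biUnion F2).card := by
        exact_mod_cast Finset.card_union_le _ _
    _ ≤ _ := by linarith

end Golfing

section Recovery

variable {n N : ℕ} {J : Finset (Fin N)}

lemma norm_inner_le_of_certificate {w₀ v z : EuclideanSpace ℂ (Fin N)} (hw₀ : restr J w₀ = w₀)
    (hvz : inner ℂ v z = 0) (h1 : ‖w₀ - restr J v‖ ≤ 1 / 4) (h2 : ∀ i ∉ J, ‖v i‖ ≤ 1 / 2) :
    ‖inner ℂ w₀ z‖ ≤ 1 / 4 * ‖restr J z‖ + 1 / 2 * ∑ i ∈ Jᶜ, ‖z i‖ := by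
  have hd : w₀ = (w₀ - restr J v) - restr Jᶜ v + v := by
    ext i
    by_cases h : i ∈ J <;> simp [restr_apply, h]
  have hs : restr J (w₀ - restr J v) = w₀ - restr J v := by
    rw [map_sub, restr_restr, hw₀]
  have h3 : ‖inner ℂ (w₀ - restr J v) z‖ ≤ 1 / 4 * ‖restr J z‖ := by
    rw [norm_inner_symm, mul_comm]
    exact (norm_inner_le_of_supported hs z).trans (by gcongr)
  have h4 : ‖inner ℂ (restr Jᶜ v) z‖ ≤ 1 / 2 * ∑ i ∈ Jᶜ, ‖z i‖ := by
    rw [inner_restr_left, PiLp.inner_apply, Finset.mul_sum,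
      ← Finset.sum_subset (Finset.subset_univ Jᶜ)]
    · refine (norm_sum_le _ _).trans (Finset.sum_le_sum fun i hi => ?_)
      refine (norm_inner_le_norm _ _).trans ?_
      rw [restr_apply, if_pos hi]
      gcongr
      exact h2 i (Finset.mem_compl.1 hi)
    · intro i _ hi
      simp [restr_apply, hi]
  calc ‖inner ℂ w₀ z‖ = ‖inner ℂ (w₀ - restr J v) z - inner ℂ (restr Jᶜ v) z‖ := by
        conv_lhs => rw [hd]
        rw [inner_add_left, hvz, add_zero, inner_sub_left]
    _ ≤ _ := (norm_sub_le _ _).trans (add_le_add h3 h4)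

/-- The directions which have to be certified in order to recover a vector `u`: its sign pattern
and the scaled coordinate vectors of its support. -/
def target (J : Finset (Fin N)) (u : Fin N → ℂ) : Option (Fin N) → EuclideanSpace ℂ (Fin N)
  | none => restr J (WithLp.toLp 2 (csgn u))
  | some i => restr J (EuclideanSpace.single i (√J.card : ℂ))

lemma restr_target (u : Fin N → ℂ) (t : Option (Fin N)) :
    restr J (target J u t) = target J u t := by
  cases t <;> exact restr_restr _ _

lemma norm_csgn_le (u : Fin N → ℂ) (i : Fin N) : ‖csgn u i‖ ≤ 1 := by
  unfold csgn
  split_ifs with h <;> simp [h]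

lemma norm_target_le (u : Fin N → ℂ) (t : Option (Fin N)) : ‖target J u t‖ ≤ √J.card := by
  cases t with
  | none =>
    refine Real.le_sqrt_of_sq_le ?_
    rw [target, norm_restr_sq]
    calc _ ≤ ∑ i ∈ J, (1 : ℝ) := by
          refine Finset.sum_le_sum fun i _ => ?_
          exact pow_le_one₀ (norm_nonneg _) (norm_csgn_le u i)
      _ = _ := by simp
  | some i =>
    have h : ‖target J u (some i)‖ ^ 2 ≤ √J.card ^ 2 := by
      rw [target, norm_restr_sq]
      refine (Finset.sum_le_univ_sum_of_nonneg fun _ => sq_nonneg _).trans ?_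
      rw [← EuclideanSpace.norm_sq_eq, PiLp.norm_single]
      simp
    exact (abs_le_of_sq_le_sq' h (Real.sqrt_nonneg _)).2

/-- If all targets are certified against `z`, then `z` is controlled by its part off `J`. -/
lemma norm_restr_le_of_target {u : Fin N → ℂ} {z : EuclideanSpace ℂ (Fin N)}
    (h : ∀ t, ‖inner ℂ (target J u t) z‖ ≤ 1 / 4 * ‖restr J z‖ + 1 / 2 * ∑ i ∈ Jᶜ, ‖z i‖) :
    ‖restr J z‖ ≤ 2 / 3 * ∑ i ∈ Jᶜ, ‖z i‖ ∧
      ‖inner ℂ (target J u none) z‖ ≤ 2 / 3 * ∑ i ∈ Jᶜ, ‖z i‖ := by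
  set A := ∑ i ∈ Jᶜ, ‖z i‖ with hA
  have hA0 : 0 ≤ A := Finset.sum_nonneg fun _ _ => norm_nonneg _
  set B := 1 / 4 * ‖restr J z‖ + 1 / 2 * A with hB
  have hB0 : 0 ≤ B := by positivity
  have hB' : ‖restr J z‖ ≤ B := by
    rcases J.eq_empty_or_nonempty with rfl | hJ
    · have : ‖restr ∅ z‖ ^ 2 = 0 := by rw [norm_restr_sq, Finset.sum_empty]
      rw [pow_eq_zero_iff two_ne_zero] at this
      rw [this]; exact hB0
    · have hc : (0 : ℝ) < J.card := by exact_mod_cast hJ.card_pos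
      refine (abs_le_of_sq_le_sq' (le_of_mul_le_mul_left ?_ hc) hB0).2
      rw [norm_restr_sq, Finset.mul_sum, ← nsmul_eq_mul]
      refine Finset.sum_le_card_nsmul _ _ _ fun i hi => ?_
      have h1 := h (some i)
      rw [target, inner_restr_left, EuclideanSpace.inner_single_left, restr_apply, if_pos hi,
        norm_mul] at h1
      simp only [RCLike.norm_conj, Complex.norm_real, Real.norm_eq_abs,
        abs_of_nonneg (Real.sqrt_nonneg _)] at h1
      calc (J.card : ℝ) * ‖z i‖ ^ 2 = (√J.card * ‖z i‖) ^ 2 := by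
            rw [mul_pow, Real.sq_sqrt hc.le]
        _ ≤ B ^ 2 := by gcongr
  have := h none
  constructor <;> linarith

lemma norm_add_re_le_norm_add (u : Fin N → ℂ) (i : Fin N) (c : ℂ) :
    ‖u i‖ + (inner ℂ (csgn u i) c : ℂ).re ≤ ‖u i + c‖ := by
  unfold csgn
  split_ifs with h
  · simp [h]
  · have h0 : (‖u i‖ : ℂ) ≠ 0 := by simpa using h
    have h1 : inner ℂ (u i / (‖u i‖ : ℂ)) (u i) = (‖u i‖ : ℂ) := by
      have h2 : u i * (starRingEnd ℂ) (u i) = (‖u i‖ : ℂ) ^ 2 := Complex.mul_conj' _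
      simp only [RCLike.inner_apply, map_div₀, Complex.conj_ofReal]
      field_simp
      rw [h2]
    have h3 : ‖u i‖ + (inner ℂ (u i / (‖u i‖ : ℂ)) c : ℂ).re =
        (inner ℂ (u i / (‖u i‖ : ℂ)) (u i + c) : ℂ).re := by
      rw [inner_add_right, Complex.add_re, h1, Complex.ofReal_re]
    rw [h3]
    refine (Complex.re_le_norm _).trans ((norm_inner_le_norm _ _).trans ?_)
    rw [norm_div, Complex.norm_real, norm_norm, div_self (by simpa using h), one_mul]

/-- Cone condition for competitors of smaller `ℓ1` norm. -/
lemma sum_compl_le_of_l1 {u : Fin N → ℂ} {z r : EuclideanSpace ℂ (Fin N)} (hJ : ∀ i ∉ J, u i = 0)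
    (h : ∑ i, ‖u i + z i + r i‖ ≤ ∑ i, ‖u i‖) :
    ∑ i ∈ Jᶜ, ‖z i‖ ≤ ‖inner ℂ (target J u none) z‖ + ∑ i, ‖r i‖ := by
  have h1 : ∑ i, ‖u i + z i‖ ≤ ∑ i, ‖u i‖ + ∑ i, ‖r i‖ := by
    refine le_trans ?_ (add_le_add_left h _)
    rw [← Finset.sum_add_distrib]
    refine Finset.sum_le_sum fun i _ => ?_
    have := norm_sub_le (u i + z i + r i) (r i)
    rwa [add_sub_cancel_right] at this
  have h2 : (inner ℂ (target J u none) z : ℂ).re = ∑ i ∈ J, (inner ℂ (csgn u i) (z i) : ℂ).re := by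
    rw [target, inner_restr_left, PiLp.inner_apply, Complex.re_sum]
    refine (Finset.sum_subset (Finset.subset_univ J) fun i _ hi => ?_).symm.trans
      (Finset.sum_congr rfl fun i hi => ?_)
    · simp [restr_apply, hi]
    · simp only [restr_apply, if_pos hi]
  have h3 : ∑ i, ‖u i‖ + (inner ℂ (target J u none) z : ℂ).re + ∑ i ∈ Jᶜ, ‖z i‖ ≤
      ∑ i, ‖u i + z i‖ := by
    rw [h2, ← Finset.sum_add_sum_compl J fun i => ‖u i‖,
      ← Finset.sum_add_sum_compl J fun i => ‖u i + z i‖,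
      Finset.sum_eq_zero (s := Jᶜ) fun i hi => by rw [hJ i (Finset.mem_compl.1 hi), norm_zero],
      add_zero, ← Finset.sum_add_distrib]
    gcongr with i hi i hi
    · exact norm_add_re_le_norm_add u i (z i)
    · rw [hJ i (Finset.mem_compl.1 hi), zero_add]
  have h4 := (abs_le.1 (Complex.abs_re_le_norm (inner ℂ (target J u none) z))).1
  linarith

lemma norm_le_sum_norm (z : EuclideanSpace ℂ (Fin N)) : ‖z‖ ≤ ∑ i, ‖z i‖ := by
  refine (abs_le_of_sq_le_sq' ?_ (Finset.sum_nonneg fun _ _ => norm_nonneg _)).2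
  rw [EuclideanSpace.norm_sq_eq]
  exact Finset.sum_sq_le_sq_sum_of_nonneg fun _ _ => norm_nonneg _

lemma sum_norm_le (z : EuclideanSpace ℂ (Fin N)) : ∑ i, ‖z i‖ ≤ √N * ‖z‖ := by
  refine (abs_le_of_sq_le_sq' ?_ (by positivity)).2
  rw [mul_pow, Real.sq_sqrt (Nat.cast_nonneg _), EuclideanSpace.norm_sq_eq]
  simpa using sq_sum_le_card_mul_sum_sq (s := Finset.univ) (f := fun i => ‖z i‖)

/-- Deterministic recovery estimate. -/
lemma norm_le_of_certified {m : ℕ} {a : Fin n → EuclideanSpace ℂ (Fin N)} {ω : Fin m → Fin n}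
    {u : Fin N → ℂ} (hJ : ∀ i ∉ J, u i = 0) (hω : ∀ t, Certified a J (target J u t) ω)
    {h : Fin n → ℂ} (hh : ∀ j, h (ω j) = 0) {z r : EuclideanSpace ℂ (Fin N)} {c : ℂ}
    (hz : ∑ k, h k • a k = c • z) (hc : c ≠ 0)
    (hl : ∑ i, ‖u i + z i + r i‖ ≤ ∑ i, ‖u i‖) :
    ‖z‖ ≤ 5 * √N * ‖r‖ := by
  have hin : ∀ t, ‖inner ℂ (target J u t) z‖ ≤ 1 / 4 * ‖restr J z‖ + 1 / 2 * ∑ i ∈ Jᶜ, ‖z i‖ := by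
    intro t
    obtain ⟨v, hv, h1, h2⟩ := hω t
    refine norm_inner_le_of_certificate (restr_target u t) ?_ h1 h2
    have := hv h hh
    rw [hz, inner_smul_right] at this
    exact (mul_eq_zero.1 this).resolve_left hc
  obtain ⟨h1, h2⟩ := norm_restr_le_of_target hin
  have h3 := sum_compl_le_of_l1 hJ hl
  have h4 := sum_norm_le r
  have h5 : z = restr J z + restr Jᶜ z := by
    ext i
    by_cases hi : i ∈ J <;> simp [restr_apply, hi]
  have h6 : ‖restr Jᶜ z‖ ≤ ∑ i ∈ Jᶜ, ‖z i‖ := by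
    refine (norm_le_sum_norm _).trans (le_of_eq ?_)
    rw [← Finset.sum_subset (Finset.subset_univ Jᶜ)]
    · exact Finset.sum_congr rfl fun i hi => by rw [restr_apply, if_pos hi]
    · intro i _ hi
      rw [restr_apply, if_neg hi, norm_zero]
  have h7 := norm_add_le (restr J z) (restr Jᶜ z)
  rw [← h5] at h7
  linarith

end Recovery

section Frame

variable {n N : ℕ}

lemma l2norm_eq {d : ℕ} (v : Fin d → ℂ) :
    l2norm v = ‖(WithLp.toLp 2 v : EuclideanSpace ℂ (Fin d))‖ :=
  (EuclideanSpace.norm_eq _).symm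

lemma l2norm_nonneg {d : ℕ} (v : Fin d → ℂ) : 0 ≤ l2norm v := Real.sqrt_nonneg _

lemma l2norm_sq {d : ℕ} (v : Fin d → ℂ) : l2norm v ^ 2 = ∑ i, ‖v i‖ ^ 2 :=
  Real.sq_sqrt (Finset.sum_nonneg fun _ _ => sq_nonneg _)

lemma l2norm_mulVec_le {d e : ℕ} (A : Matrix (Fin d) (Fin e) ℂ) (v : Fin e → ℂ) :
    l2norm (A.mulVec v) ≤ specNorm A * l2norm v := by
  rw [l2norm_eq, l2norm_eq]
  exact (LinearMap.toContinuousLinearMap (Matrix.toEuclideanLin A)).le_opNorm (WithLp.toLp 2 v)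

lemma specNorm_nonneg {d e : ℕ} (A : Matrix (Fin d) (Fin e) ℂ) : 0 ≤ specNorm A := norm_nonneg _

lemma star_dotProduct_self {d : ℕ} (v : Fin d → ℂ) : star v ⬝ᵥ v = ((l2norm v ^ 2 : ℝ) : ℂ) := by
  rw [l2norm_sq, dotProduct]
  push_cast
  exact Finset.sum_congr rfl fun i _ => Complex.conj_mul' _

lemma abs_frame_sub_le (T : Matrix (Fin N) (Fin n) ℂ) (γ : ℝ) (h : Fin n → ℂ) :
    |γ * l2norm (T.mulVec h) ^ 2 - l2norm h ^ 2| ≤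
      specNorm ((γ : ℂ) • (Tᴴ * T) - 1) * l2norm h ^ 2 := by
  set M : Matrix (Fin n) (Fin n) ℂ := (γ : ℂ) • (Tᴴ * T) - 1 with hM
  have h1 : star h ⬝ᵥ M.mulVec h = ((γ * l2norm (T.mulVec h) ^ 2 - l2norm h ^ 2 : ℝ) : ℂ) := by
    rw [hM, Matrix.sub_mulVec, Matrix.one_mulVec, Matrix.smul_mulVec, ← Matrix.mulVec_mulVec,
      dotProduct_sub, dotProduct_smul, Matrix.dotProduct_mulVec, ← Matrix.star_mulVec,
      star_dotProduct_self, star_dotProduct_self]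
    simp
  have h2 : ‖star h ⬝ᵥ M.mulVec h‖ ≤ l2norm h * l2norm (M.mulVec h) := by
    rw [dotProduct_comm, ← EuclideanSpace.inner_toLp_toLp, l2norm_eq, l2norm_eq]
    exact norm_inner_le_norm _ _
  rw [h1, Complex.norm_real, Real.norm_eq_abs] at h2
  refine h2.trans ?_
  calc l2norm h * l2norm (M.mulVec h) ≤ l2norm h * (specNorm M * l2norm h) := by
        gcongr
        · exact l2norm_nonneg _
        · exact l2norm_mulVec_le _ _
    _ = _ := by ring

/-- The Bessel inequality obtained from the upper bound of the synthesis operator. -/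
lemma sum_norm_inner_sq_le {a : Fin n → EuclideanSpace ℂ (Fin N)}
    (ha : ∀ h : Fin n → ℂ, ‖∑ k, h k • a k‖ ^ 2 ≤ 2 * ∑ k, ‖h k‖ ^ 2)
    (w : EuclideanSpace ℂ (Fin N)) : ∑ k, ‖inner ℂ (a k) w‖ ^ 2 ≤ 2 * ‖w‖ ^ 2 := by
  set G := ∑ k, ‖inner ℂ (a k) w‖ ^ 2 with hG
  have hG0 : 0 ≤ G := Finset.sum_nonneg fun _ _ => sq_nonneg _
  have h1 : inner ℂ (∑ k, inner ℂ (a k) w • a k) w = (G : ℂ) := by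
    rw [sum_inner, hG]
    push_cast
    refine Finset.sum_congr rfl fun k _ => ?_
    rw [inner_smul_left]
    exact Complex.conj_mul' _
  have h2 := norm_inner_le_norm (𝕜 := ℂ) (∑ k, inner ℂ (a k) w • a k) w
  rw [h1, Complex.norm_real, Real.norm_of_nonneg hG0] at h2
  have h3 := ha fun k => inner ℂ (a k) w
  have h4 : G ^ 2 ≤ (2 * G) * ‖w‖ ^ 2 := by
    calc G ^ 2 ≤ (‖∑ k, inner ℂ (a k) w • a k‖ * ‖w‖) ^ 2 := by gcongr
      _ = ‖∑ k, inner ℂ (a k) w • a k‖ ^ 2 * ‖w‖ ^ 2 := mul_pow _ _ _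
      _ ≤ _ := by gcongr
  rcases hG0.eq_or_lt with h | h
  · rw [← h]; positivity
  · nlinarith

/-- The columns of a matrix, scaled by a constant. -/
def scaledCol (c : ℂ) (A : Matrix (Fin N) (Fin n) ℂ) (k : Fin n) : EuclideanSpace ℂ (Fin N) :=
  WithLp.toLp 2 fun i => c * A i k

lemma sum_smul_scaledCol (c : ℂ) (A : Matrix (Fin N) (Fin n) ℂ) (h : Fin n → ℂ) :
    ∑ k, h k • scaledCol c A k = c • (WithLp.toLp 2 (A.mulVec h) : EuclideanSpace ℂ (Fin N)) := by
  ext i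
  simp only [scaledCol, PiLp.smul_apply, WithLp.ofLp_sum, Finset.sum_apply, smul_eq_mul,
    Matrix.mulVec, dotProduct, Finset.mul_sum, WithLp.ofLp_smul, Pi.smul_apply]
  exact Finset.sum_congr rfl fun k _ => by ring

lemma inner_scaledCol (c d : ℂ) (A B : Matrix (Fin N) (Fin n) ℂ) (j k : Fin n) :
    inner ℂ (scaledCol c A j) (scaledCol d B k) = star c * d * (Aᴴ * B) j k := by
  simp only [scaledCol, PiLp.inner_apply, RCLike.inner_apply, Matrix.mul_apply, Finset.mul_sum,
    Matrix.conjTranspose_apply, map_mul, starRingEnd_apply]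
  exact Finset.sum_congr rfl fun i _ => by ring

lemma norm_le_linfnorm {d : ℕ} (v : Fin d → ℂ) (i : Fin d) : ‖v i‖ ≤ linfnorm v :=
  le_ciSup (f := fun i => ‖v i‖) (Set.finite_range _).bddAbove i

lemma norm_scaledCol_sq_le {A : Matrix (Fin N) (Fin n) ℂ} {γ : ℝ} (hγ : 0 ≤ γ) (k : Fin n)
    (i : Fin N) : n * ‖scaledCol (√γ : ℂ) A k i‖ ^ 2 ≤ locIncoh γ A k := by
  have h := norm_le_linfnorm (fun i => A i k) i
  simp only [scaledCol, locIncoh, norm_mul, Complex.norm_real, Real.norm_eq_abs,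
    abs_of_nonneg (Real.sqrt_nonneg γ), mul_pow, Real.sq_sqrt hγ, ← mul_assoc]
  gcongr

lemma locIncoh_le_incoherence {γ : ℝ} (T Ttil : Matrix (Fin N) (Fin n) ℂ) (k : Fin n) :
    locIncoh γ T k ≤ incoherence γ T Ttil ∧ locIncoh γ⁻¹ Ttil k ≤ incoherence γ T Ttil := by
  rw [← max_le_iff]
  exact le_ciSup (f := fun k => max (locIncoh γ T k) (locIncoh γ⁻¹ Ttil k))
    (Set.finite_range _).bddAbove k

lemma pinv_mul_self {T : Matrix (Fin N) (Fin n) ℂ} {Tdag : Matrix (Fin n) (Fin N) ℂ}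
    (hT : Function.Injective T.mulVec) (h : IsMoorePenrose T Tdag) : Tdag * T = 1 := by
  refine Matrix.ext_of_mulVec_single fun k => hT ?_
  rw [Matrix.mulVec_mulVec, Matrix.mulVec_mulVec, ← Matrix.mul_assoc, h.1, Matrix.mul_one]

lemma l2norm_col_le_maxColL2 (A : Matrix (Fin N) (Fin n) ℂ) (k : Fin n) :
    l2norm (fun i => A i k) ≤ maxColL2 A :=
  le_ciSup (f := fun k => l2norm fun i => A i k) (Set.finite_range _).bddAbove k

lemma maxColL2_nonneg (A : Matrix (Fin N) (Fin n) ℂ) : 0 ≤ maxColL2 A :=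
  Real.iSup_nonneg fun _ => l2norm_nonneg _

lemma one_le_maxColL2_mul {T : Matrix (Fin N) (Fin n) ℂ} {Tdag : Matrix (Fin n) (Fin N) ℂ}
    (hn : 0 < n) (h : Tdag * T = 1) : 1 ≤ maxColL2 T * maxColL2 Tdagᴴ := by
  have h1 := inner_scaledCol 1 1 Tdagᴴ T ⟨0, hn⟩ ⟨0, hn⟩
  rw [Matrix.conjTranspose_conjTranspose, h, Matrix.one_apply_eq] at h1
  have h2 := norm_inner_le_norm (𝕜 := ℂ) (scaledCol 1 Tdagᴴ ⟨0, hn⟩) (scaledCol 1 T ⟨0, hn⟩)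
  rw [h1] at h2
  have h3 : ∀ A : Matrix (Fin N) (Fin n) ℂ, ‖scaledCol 1 A ⟨0, hn⟩‖ ≤ maxColL2 A := by
    intro A
    refine le_trans (le_of_eq ?_) (l2norm_col_le_maxColL2 A ⟨0, hn⟩)
    rw [l2norm_eq, scaledCol]
    simp only [one_mul]
  rw [mul_comm]
  refine le_trans (by simpa using h2) (mul_le_mul (h3 _) (h3 _) (norm_nonneg _) (maxColL2_nonneg _))

lemma card_le_of_injective {T : Matrix (Fin N) (Fin n) ℂ} (hT : Function.Injective T.mulVec) :
    n ≤ N := by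
  have := LinearMap.finrank_le_finrank_of_injective (f := T.mulVecLin) hT
  simpa using this

/-- The uncertainty principle: a vector with few nonzero coefficients forces large incoherence. -/
lemma one_sub_le_card_mul {T Ttil : Matrix (Fin N) (Fin n) ℂ} {γ : ℝ} (hγ : 0 < γ) (hn : 0 < n)
    {x : Fin n → ℂ} (hx : x ≠ 0) :
    1 - specNorm ((γ : ℂ) • (Tᴴ * T) - 1) ≤ sparsity (T.mulVec x) * incoherence γ T Ttil := by
  set μ := incoherence γ T Ttil
  have hx0 : 0 < l2norm x ^ 2 := by
    rw [l2norm_eq]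
    have : (WithLp.toLp 2 x : EuclideanSpace ℂ (Fin n)) ≠ 0 := by simpa using hx
    positivity
  have h1 := (abs_le.1 (abs_frame_sub_le T γ x)).1
  have h2 : ∀ i, γ * ‖T.mulVec x i‖ ^ 2 ≤ μ * l2norm x ^ 2 := by
    intro i
    have h3 : ‖T.mulVec x i‖ ^ 2 ≤ (∑ k, ‖T i k‖ ^ 2) * l2norm x ^ 2 := by
      rw [l2norm_sq]
      refine le_trans ?_ (Finset.sum_mul_sq_le_sq_mul_sq _ _ _)
      gcongr
      refine (norm_sum_le Finset.univ fun k => T i k * x k).trans (le_of_eq ?_)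
      exact Finset.sum_congr rfl fun k _ => norm_mul _ _
    have h4 : γ * ∑ k, ‖T i k‖ ^ 2 ≤ μ := by
      have hn' : (0 : ℝ) < n := by exact_mod_cast hn
      refine le_of_mul_le_mul_left ?_ hn'
      rw [← mul_assoc, Finset.mul_sum]
      refine (Finset.sum_le_card_nsmul _ _ μ fun k _ => ?_).trans (by simp)
      refine le_trans ?_ (locIncoh_le_incoherence T Ttil k).1
      rw [locIncoh]
      gcongr
      exact norm_le_linfnorm (fun i => T i k) i
    nlinarith
  have h5 : γ * l2norm (T.mulVec x) ^ 2 ≤ sparsity (T.mulVec x) * (μ * l2norm x ^ 2) := by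
    rw [l2norm_sq, sparsity, Finset.mul_sum, ← nsmul_eq_mul,
      ← Finset.sum_subset (Finset.subset_univ (Finset.univ.filter fun i => T.mulVec x i ≠ 0))]
    · exact Finset.sum_le_card_nsmul _ _ _ fun i _ => h2 i
    · intro i _ hi
      have : T.mulVec x i = 0 := by simpa using hi
      simp [this]
  refine le_of_mul_le_mul_right ?_ hx0
  linarith

lemma sigmaMin_mul_le (A : Matrix (Fin N) (Fin n) ℂ) (h : Fin n → ℂ) :
    sigmaMin A * l2norm h ≤ l2norm (A.mulVec h) := by
  rcases (l2norm_nonneg h).eq_or_lt with h0 | h0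
  · rw [← h0, mul_zero]; exact l2norm_nonneg _
  have hs : ∀ {d : ℕ} (v : Fin d → ℂ), l2norm ((((l2norm h)⁻¹ : ℝ) : ℂ) • v) =
      (l2norm h)⁻¹ * l2norm v := by
    intro d v
    rw [l2norm_eq v, l2norm_eq, WithLp.toLp_smul, norm_smul, Complex.norm_real, Real.norm_of_nonneg
      (inv_nonneg.2 h0.le)]
  have h1 : sigmaMin A ≤ (l2norm h)⁻¹ * l2norm (A.mulVec h) := by
    refine csInf_le ⟨0, ?_⟩ ⟨(((l2norm h)⁻¹ : ℝ) : ℂ) • h, ?_, ?_⟩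
    · rintro r ⟨v, -, rfl⟩
      exact l2norm_nonneg _
    · rw [hs, inv_mul_cancel₀ h0.ne']
    · rw [Matrix.mulVec_smul, hs]
  calc sigmaMin A * l2norm h ≤ (l2norm h)⁻¹ * l2norm (A.mulVec h) * l2norm h := by gcongr
    _ = _ := by field_simp

lemma sigmaMin_pos {T : Matrix (Fin N) (Fin n) ℂ} {γ : ℝ} (hγ : 0 < γ) (hn : 0 < n)
    (hδ : specNorm ((γ : ℂ) • (Tᴴ * T) - 1) < 1) : 0 < sigmaMin T := by
  set δ := specNorm ((γ : ℂ) • (Tᴴ * T) - 1)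
  have hpos : 0 < √((1 - δ) / γ) := Real.sqrt_pos.2 (div_pos (by linarith) hγ)
  refine hpos.trans_le (le_csInf ⟨_, Pi.single ⟨0, hn⟩ 1, ?_, rfl⟩ ?_)
  · rw [l2norm_eq]
    exact (PiLp.norm_single 2 _ _ _).trans norm_one
  · rintro r ⟨v, hv, rfl⟩
    have h1 := (abs_le.1 (abs_frame_sub_le T γ v)).1
    rw [hv] at h1
    refine Real.sqrt_le_iff.2 ⟨l2norm_nonneg _, ?_⟩
    rw [div_le_iff₀ hγ]
    linarith

lemma norm_sum_smul_scaledCol_sq_le {T : Matrix (Fin N) (Fin n) ℂ} {γ : ℝ} (hγ : 0 < γ)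
    (hδ : specNorm ((γ : ℂ) • (Tᴴ * T) - 1) < 1) (h : Fin n → ℂ) :
    ‖∑ k, h k • scaledCol (√γ : ℂ) T k‖ ^ 2 ≤ 2 * ∑ k, ‖h k‖ ^ 2 := by
  have h1 := (abs_le.1 (abs_frame_sub_le T γ h)).2
  rw [sum_smul_scaledCol, norm_smul, mul_pow, Complex.norm_real, Real.norm_eq_abs, sq_abs,
    Real.sq_sqrt hγ.le, ← l2norm_eq, ← l2norm_sq]
  nlinarith [sq_nonneg (l2norm h)]

end Frame

section Sampling

variable {n N m : ℕ}

lemma ofReal_le_pi_of_card_le (hn : 0 < n) (ν : Measure (Fin n)) [IsProbabilityMeasure ν]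
    (hν : ∀ k, ν {k} = (n : ℝ≥0∞)⁻¹) {S : Set (Fin m → Fin n)} {B : Finset (Fin m → Fin n)}
    (hS : ∀ ω ∉ B, ω ∈ S) {p : ℝ} (hp : 0 ≤ p) (hB : (B.card : ℝ) ≤ p * n ^ m) :
    ENNReal.ofReal (1 - p) ≤ (Measure.pi fun _ : Fin m => ν) S := by
  have h1 : (Measure.pi fun _ : Fin m => ν) B ≤ ENNReal.ofReal p := by
    rw [← sum_measure_singleton]
    have h2 : ∀ ω : Fin m → Fin n, (Measure.pi fun _ : Fin m => ν) {ω} =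
        ENNReal.ofReal ((n ^ m : ℝ)⁻¹) := by
      intro ω
      rw [Measure.pi_singleton]
      simp only [hν, Finset.prod_const, Finset.card_univ, Fintype.card_fin]
      rw [ENNReal.ofReal_inv_of_pos (by positivity), ENNReal.ofReal_pow (Nat.cast_nonneg _),
        ENNReal.ofReal_natCast, ENNReal.inv_pow]
    rw [Finset.sum_congr rfl fun ω _ => h2 ω, Finset.sum_const, nsmul_eq_mul,
      ← ENNReal.ofReal_natCast, ← ENNReal.ofReal_mul (Nat.cast_nonneg _)]
    refine ENNReal.ofReal_le_ofReal ?_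
    rw [← div_eq_mul_inv, div_le_iff₀ (by positivity)]
    exact hB
  calc ENNReal.ofReal (1 - p) = 1 - ENNReal.ofReal p := by
        rw [ENNReal.ofReal_sub _ hp, ENNReal.ofReal_one]
    _ ≤ 1 - (Measure.pi fun _ : Fin m => ν) B := tsub_le_tsub_left h1 _
    _ = (Measure.pi fun _ : Fin m => ν) (B : Set (Fin m → Fin n))ᶜ :=
        (prob_compl_eq_one_sub B.measurableSet).symm
    _ ≤ _ := measure_mono fun ω hω => hS ω (by simpa using hω)

lemma certified_of_eq_zero {a : Fin n → EuclideanSpace ℂ (Fin N)} {J : Finset (Fin N)}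
    {w₀ : EuclideanSpace ℂ (Fin N)} (h : w₀ = 0) (ω : Fin m → Fin n) : Certified a J w₀ ω :=
  ⟨0, fun _ _ => inner_zero_left _, by simp [h], by simp⟩

lemma projMat_mulVec {d : ℕ} (I : Set (Fin d)) (v : Fin d → ℂ) (i : Fin d) :
    (projMat I).mulVec v i = if i ∈ I then v i else 0 := by
  simp only [Matrix.mulVec, dotProduct, projMat]
  rw [Finset.sum_eq_single i]
  · by_cases h : i ∈ I <;> simp [h]
  · intro j _ hj
    simp [hj.symm]
  · simp

/-- Stable recovery on the event that all targets are certified. -/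
lemma l2norm_sub_le_of_certified {T : Matrix (Fin N) (Fin n) ℂ} {γ ε K : ℝ}
    {x xsharp xhat : Fin n → ℂ} {ω : Fin m → Fin n} (hγ : 0 < γ) (hσ : 0 < sigmaMin T) (hε : 0 ≤ ε)
    (hK : 10 * √N ≤ K)
    (hω : ∀ t, Certified (scaledCol (√γ : ℂ) T)
      (Finset.univ.filter fun i => T.mulVec x i ≠ 0)
      (target (Finset.univ.filter fun i => T.mulVec x i ≠ 0) (T.mulVec x) t) ω)
    (hx : l2norm ((projMat (Set.range ω)).mulVec (x - xsharp)) ≤ ε)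
    (hxhat : l2norm ((projMat (Set.range ω)).mulVec (xhat - xsharp)) ≤ ε)
    (hmin : l1norm (T.mulVec xhat) ≤ l1norm (T.mulVec x)) :
    l2norm (xhat - x) ≤ sigmaMax T / sigmaMin T * (2 + K) * ε := by
  set P := projMat (Set.range ω)
  set h₁ : Fin n → ℂ := P.mulVec (xhat - x) with hh₁
  set h₀ : Fin n → ℂ := (xhat - x) - h₁ with hh₀
  have hsplit : xhat - x = h₀ + h₁ := by simp [hh₀]
  have hnorm₁ : l2norm h₁ ≤ 2 * ε := by
    have h : h₁ = P.mulVec (xhat - xsharp) - P.mulVec (x - xsharp) := by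
      rw [hh₁, ← Matrix.mulVec_sub, sub_sub_sub_cancel_right]
    rw [l2norm_eq] at hx hxhat ⊢
    rw [h, WithLp.toLp_sub]
    linarith [norm_sub_le (WithLp.toLp 2 (P.mulVec (xhat - xsharp)) : EuclideanSpace ℂ (Fin n))
      (WithLp.toLp 2 (P.mulVec (x - xsharp)))]
  have hzero : ∀ j, h₀ (ω j) = 0 := by
    intro j
    rw [hh₀, Pi.sub_apply, hh₁, projMat_mulVec, if_pos ⟨j, rfl⟩, sub_self]
  have hr : l2norm (T.mulVec h₁) ≤ sigmaMax T * (2 * ε) :=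
    (l2norm_mulVec_le T h₁).trans (mul_le_mul_of_nonneg_left hnorm₁ (specNorm_nonneg T))
  have hz : l2norm (T.mulVec h₀) ≤ 5 * √N * l2norm (T.mulVec h₁) := by
    rw [l2norm_eq, l2norm_eq]
    refine norm_le_of_certified (u := T.mulVec x) (by simp) hω hzero
      (sum_smul_scaledCol _ T h₀) ?_ ?_
    · exact_mod_cast (Real.sqrt_pos.2 hγ).ne'
    · refine le_trans (le_of_eq ?_) hmin
      have : xhat = x + h₀ + h₁ := by rw [add_assoc, ← hsplit, add_sub_cancel]
      rw [this, Matrix.mulVec_add, Matrix.mulVec_add]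
      rfl
  have hT : l2norm (T.mulVec (xhat - x)) ≤ l2norm (T.mulVec h₀) + l2norm (T.mulVec h₁) := by
    rw [hsplit, Matrix.mulVec_add, l2norm_eq, l2norm_eq, l2norm_eq, WithLp.toLp_add]
    exact norm_add_le _ _
  have hS : 0 ≤ sigmaMax T := specNorm_nonneg T
  have hmain : sigmaMin T * l2norm (xhat - x) ≤ sigmaMax T * (2 + K) * ε := by
    calc sigmaMin T * l2norm (xhat - x) ≤ l2norm (T.mulVec (xhat - x)) := sigmaMin_mul_le _ _
      _ ≤ (5 * √N + 1) * l2norm (T.mulVec h₁) := by linarith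
      _ ≤ (5 * √N + 1) * (sigmaMax T * (2 * ε)) := by gcongr
      _ = sigmaMax T * (2 + 10 * √N) * ε := by ring
      _ ≤ _ := by gcongr
  rw [div_mul_eq_mul_div, div_mul_eq_mul_div, le_div_iff₀ hσ, mul_comm]
  exact hmain

lemma certification_failure_le {β r : ℝ} (hN : 4 ≤ N) (hβ : 0 < β)
    (hr : 8 * (1 + β) * Real.log N ≤ r) :
    (N + 1) * (20 * N) * Real.exp (-r) ≤ Real.exp (-β) := by
  have hN' : (4 : ℝ) ≤ N := by exact_mod_cast hN
  have hN0 : (0 : ℝ) < N := by linarith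
  have hlog : 1 ≤ Real.log N := by
    rw [Real.le_log_iff_exp_le hN0]
    linarith [Real.exp_one_lt_d9]
  have h1 : Real.exp (-r) ≤ ((N : ℝ) ^ 8)⁻¹ * Real.exp (-β) := by
    have h2 : ((N : ℝ) ^ 8)⁻¹ = Real.exp (-(8 * Real.log N)) := by
      rw [Real.exp_neg, ← Real.exp_log (pow_pos hN0 8), Real.log_pow]
      norm_num
    rw [h2, ← Real.exp_add]
    refine Real.exp_le_exp.2 ?_
    nlinarith
  have h3 : (N + 1) * (20 * N) ≤ (N : ℝ) ^ 8 := by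
    have h4 : (4 : ℝ) ^ 6 ≤ (N : ℝ) ^ 6 := by gcongr
    calc ((N : ℝ) + 1) * (20 * N) ≤ 4 ^ 6 * (N : ℝ) ^ 2 := by nlinarith
      _ ≤ (N : ℝ) ^ 6 * (N : ℝ) ^ 2 := by gcongr
      _ = (N : ℝ) ^ 8 := by ring
  calc (N + 1) * (20 * N) * Real.exp (-r) ≤ (N : ℝ) ^ 8 * (((N : ℝ) ^ 8)⁻¹ * Real.exp (-β)) := by
        gcongr
    _ = _ := by field_simp

/-- The number of samples for which some target fails to be certified. -/
lemma card_exists_not_certified_le {s : ℕ} {T : Matrix (Fin N) (Fin n) ℂ}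
    {Tdag : Matrix (Fin n) (Fin N) ℂ} {γ β : ℝ} {x : Fin n → ℂ} (hn : 4 ≤ n) (hm : 0 < m)
    (hT : Function.Injective T.mulVec) (hdag : IsMoorePenrose T Tdag) (hγ : 0 < γ)
    (hδ : specNorm ((γ : ℂ) • (Tᴴ * T) - 1) < 1) (hs : sparsity (T.mulVec x) ≤ s) (hβ : 0 < β)
    (hmC : (m : ℝ) ≥ 65536 * (1 + β) * incoherence γ T Tdagᴴ * s /
      (1 - specNorm ((γ : ℂ) • (Tᴴ * T) - 1)) *
      (Real.log N + Real.log (maxColL2 T * maxColL2 Tdagᴴ))) :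
    ((Finset.univ.biUnion fun t => Finset.univ.filter fun ω : Fin m → Fin n =>
      ¬ Certified (scaledCol (√γ : ℂ) T) (Finset.univ.filter fun i => T.mulVec x i ≠ 0)
        (target (Finset.univ.filter fun i => T.mulVec x i ≠ 0) (T.mulVec x) t) ω).card : ℝ) ≤
      Real.exp (-β) * n ^ m := by
  set J := Finset.univ.filter fun i => T.mulVec x i ≠ 0 with hJ
  set μ := incoherence γ T Tdagᴴ with hμ
  set δ := specNorm ((γ : ℂ) • (Tᴴ * T) - 1) with hδ'
  have hn0 : 0 < n := by omega
  have hN : 4 ≤ N := hn.trans (card_le_of_injective hT)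
  rcases J.eq_empty_or_nonempty with hJ0 | hJ0
  · have hempty : ∀ t, target J (T.mulVec x) t = 0 := by
      intro t
      rw [← restr_target, hJ0]
      ext i
      simp [restr_apply]
    rw [Finset.card_eq_zero.2]
    · rw [Nat.cast_zero]; positivity
    · refine Finset.eq_empty_iff_forall_notMem.2 fun ω hω => ?_
      obtain ⟨t, -, ht⟩ := Finset.mem_biUnion.1 hω
      exact (Finset.mem_filter.1 ht).2 (certified_of_eq_zero (hempty t) ω)
  have hx : x ≠ 0 := by
    rintro rfl
    simp [hJ] at hJ0
  have hJcard : (0 : ℝ) < J.card := by exact_mod_cast hJ0.card_pos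
  have hδ0 : 0 ≤ δ := specNorm_nonneg _
  have hδ1 : 0 < 1 - δ := by linarith
  have hunc : 1 - δ ≤ J.card * μ := one_sub_le_card_mul hγ hn0 hx
  have hμ0 : 0 < μ := pos_of_mul_pos_right (hδ1.trans_le hunc) hJcard.le
  set σ := J.card * μ / (1 - δ) with hσ
  have hσ1 : 1 ≤ σ := by rw [hσ, one_le_div hδ1]; exact hunc
  have hσ2 : J.card * μ ≤ σ := le_div_self (by positivity) hδ1 (by linarith)
  have hpinv := pinv_mul_self hT hdag
  have hκ : 0 ≤ Real.log (maxColL2 T * maxColL2 Tdagᴴ) :=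
    Real.log_nonneg (one_le_maxColL2_mul hn0 hpinv)
  have hlogN : 0 ≤ Real.log N := Real.log_nonneg (by exact_mod_cast (by omega : 1 ≤ N))
  have hs' : (J.card : ℝ) ≤ s := by exact_mod_cast hs
  have hsize : 8 * (1 + β) * Real.log N ≤ m / σ / 8192 := by
    rw [div_div, le_div_iff₀ (by positivity)]
    refine le_trans ?_ hmC
    calc 8 * (1 + β) * Real.log N * (σ * 8192)
        = 65536 * (1 + β) * μ * J.card / (1 - δ) * (Real.log N + 0) := by rw [hσ]; ring
      _ ≤ _ := by gcongr
  have hγs : (√γ : ℂ) ≠ 0 := by exact_mod_cast (Real.sqrt_pos.2 hγ).ne'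
  have hsingle : ∀ t, ((Finset.univ.filter fun ω : Fin m → Fin n =>
      ¬ Certified (scaledCol (√γ : ℂ) T) J (target J (T.mulVec x) t) ω).card : ℝ) ≤
      20 * N * (n ^ m * Real.exp (-(m / σ / 8192))) := by
    intro t
    refine card_not_certified_le (b := scaledCol (√γ⁻¹ : ℂ) Tdagᴴ) hn0 hm hσ1 hμ0.le
      (fun k i => ?_) (fun k i => ?_)
      (sum_norm_inner_sq_le (norm_sum_smul_scaledCol_sq_le hγ hδ)) (fun j k => ?_)
      hσ2 hJ0.card_pos (restr_target _ t) (norm_target_le _ t)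
    · exact (norm_scaledCol_sq_le hγ.le k i).trans (locIncoh_le_incoherence T Tdagᴴ k).1
    · exact (norm_scaledCol_sq_le (inv_nonneg.2 hγ.le) k i).trans
        (locIncoh_le_incoherence T Tdagᴴ k).2
    · rw [inner_scaledCol, Matrix.conjTranspose_conjTranspose, hpinv, Matrix.one_apply,
        Real.sqrt_inv, Complex.ofReal_inv, star_inv₀, Complex.star_def, Complex.conj_ofReal,
        inv_mul_cancel₀ hγs, one_mul]
  calc _ ≤ ∑ t : Option (Fin N), ((Finset.univ.filter fun ω : Fin m → Fin n =>
        ¬ Certified (scaledCol (√γ : ℂ) T) J (target J (T.mulVec x) t) ω).card : ℝ) := by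
        exact_mod_cast Finset.card_biUnion_le
    _ ≤ ∑ t : Option (Fin N), 20 * N * (n ^ m * Real.exp (-(m / σ / 8192))) :=
        Finset.sum_le_sum fun t _ => hsingle t
    _ = (N + 1) * (20 * N) * Real.exp (-(m / σ / 8192)) * n ^ m := by
        rw [Finset.sum_const, Finset.card_univ, Fintype.card_option, Fintype.card_fin, nsmul_eq_mul]
        push_cast
        ring
    _ ≤ _ := by
        gcongr
        exact certification_failure_le hN hβ hsize

end Sampling

/-- Theorem 2 (stable recovery from noisy uniform random samples). -/
theorem stability1_uniform_sampling :
    ∃ C : ℝ, 0 < C ∧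
      ∀ (n N m s : ℕ), 0 < n → 0 < N → 0 < m → 0 < s →
      ∀ (T : Matrix (Fin N) (Fin n) ℂ) (Tdag : Matrix (Fin n) (Fin N) ℂ) (γ β ε : ℝ)
        (x xsharp : Fin n → ℂ) (ν : Measure (Fin n)) [IsProbabilityMeasure ν],
        Function.Injective T.mulVec →
        IsMoorePenrose T Tdag →
        IsBalancing T γ →
        specNorm ((γ : ℂ) • (Tᴴ * T) - 1) < 1 →
        (∀ k, ν {k} = (n : ℝ≥0∞)⁻¹) →
        sparsity (T.mulVec x) ≤ s →
        0 < β → 0 ≤ ε →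
        (m : ℝ) ≥ C * (1 + β) * incoherence γ T Tdagᴴ * s /
            (1 - specNorm ((γ : ℂ) • (Tᴴ * T) - 1)) *
            (Real.log N + Real.log (maxColL2 T * maxColL2 Tdagᴴ)) →
        (Measure.pi fun _ : Fin m => ν)
            {ω | l2norm ((projMat (Set.range ω)).mulVec (x - xsharp)) ≤ ε →
                ∀ xhat : Fin n → ℂ,
                  l2norm ((projMat (Set.range ω)).mulVec (xhat - xsharp)) ≤ ε →
                  (∀ g : Fin n → ℂ,
                      l2norm ((projMat (Set.range ω)).mulVec (g - xsharp)) ≤ ε →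
                      l1norm (T.mulVec xhat) ≤ l1norm (T.mulVec g)) →
                  l2norm (xhat - x) ≤ sigmaMax T / sigmaMin T *
                    (2 + 28 * Real.sqrt N *
                      (3 * n * maxColL2 T * maxColL2 Tdagᴴ + 1)) * ε} ≥
          ENNReal.ofReal (1 - Real.exp (-β) - 3 / n) := by
  refine ⟨65536, by norm_num, ?_⟩
  intro n N m s hn hN hm hs T Tdag γ β ε x xsharp ν _ hT hdag hbal hδ hν hsp hβ hε hmC
  have hγ := hbal.1
  rcases lt_or_ge n 4 with hn4 | hn4
  · have h3 : (1 : ℝ) ≤ 3 / n := by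
      rw [one_le_div (by exact_mod_cast hn)]
      exact_mod_cast Nat.le_of_lt_succ hn4
    have h0 : 1 - Real.exp (-β) - 3 / n ≤ 0 := by linarith [Real.exp_pos (-β)]
    rw [ENNReal.ofReal_of_nonpos h0]
    exact zero_le
  refine le_trans (ENNReal.ofReal_le_ofReal (sub_le_self _ (by positivity)))
    (ofReal_le_pi_of_card_le hn ν hν (fun ω hω => ?_) (Real.exp_pos _).le
      (card_exists_not_certified_le hn4 hm hT hdag hγ hδ hsp hβ hmC))
  intro hx xhat hxhat hmin
  refine l2norm_sub_le_of_certified hγ (sigmaMin_pos hγ hn hδ) hε ?_ (fun t => ?_) hx hxhat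
    (hmin x hx)
  · have h1 : 0 ≤ 3 * n * maxColL2 T * maxColL2 Tdagᴴ :=
      mul_nonneg (mul_nonneg (by positivity) (maxColL2_nonneg T)) (maxColL2_nonneg _)
    nlinarith [Real.sqrt_nonneg N]
  · by_contra hcert
    exact hω (Finset.mem_biUnion.2 ⟨t, Finset.mem_univ _, Finset.mem_filter.2
      ⟨Finset.mem_univ _, hcert⟩⟩)

end TSR
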